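/- arXiv:1701.08115 — 2 statements merged into one kernel-verified Lean document; each statement's English description precedes it below -/
import Mathlib

section
/- Let k ≥ 3 and let γ > 0. There exists m₀ (depending on γ and k) such that for all m ≥ m₀ the following holds. Let H be a k-graph on n ≥ m vertices with δ_{k−1}(H) ≥ (1/2 + γ)n, and let x, y ∈ V(H) be distinct. Then the number of m-element sets R ⊆ V(H) ∖ {x, y} such that δ_{k−1}(H[R ∪ {x, y}]) ≥ (1/2 + γ/2)(m + 2) is at least binom(n−2, m)/2. -/
set_option autoImplicit false

open Finset

section Defs

variable {V : Type} [Fintype V] [DecidableEq V]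

/-- `E` is the edge set of a `k`-uniform hypergraph on `V`. -/
def IsKGraph (k : ℕ) (E : Finset (Finset V)) : Prop := ∀ e ∈ E, e.card = k

/-- The degree of a vertex set `S`: the number of edges containing `S`. -/
def degS (E : Finset (Finset V)) (S : Finset V) : ℕ := (E.filter fun e => S ⊆ e).card

/-- `C` is the (cyclically ordered) vertex list of a copy of a tight cycle:
the vertices are distinct and every `k` cyclically consecutive vertices form an edge. -/
def IsTightCycleList (k : ℕ) (E : Finset (Finset V)) (C : List V) : Prop :=
  C.Nodup ∧ ∀ i < C.length, (((C ++ C).drop i).take k).toFinset ∈ E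

/-- `H` has a `C_s^k`-covering: every vertex lies in a copy of the tight cycle on `s` vertices. -/
def HasCsCovering (k s : ℕ) (E : Finset (Finset V)) : Prop :=
  ∀ v : V, ∃ C : List V, C.length = s ∧ IsTightCycleList k E C ∧ v ∈ C

/-- `H` contains a copy of `C_s^k`. -/
def HasCsCopy (k s : ℕ) (E : Finset (Finset V)) : Prop :=
  ∃ C : List V, C.length = s ∧ IsTightCycleList k E C

/-- `A` is the vertex set of a copy of `C_s^k` in `H`. -/
def SpansCs (k s : ℕ) (E : Finset (Finset V)) (A : Finset V) : Prop :=
  ∃ C : List V, C.length = s ∧ IsTightCycleList k E C ∧ C.toFinset = A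

/-- a `C_s^k`-tiling: a set of pairwise disjoint vertex sets of copies of `C_s^k`. -/
def IsCsTiling (k s : ℕ) (E : Finset (Finset V)) (T : Finset (Finset V)) : Prop :=
  (T : Set (Finset V)).PairwiseDisjoint id ∧ ∀ A ∈ T, SpansCs k s E A

/-- a perfect `C_s^k`-tiling of the induced subgraph on `U`. -/
def HasPerfectCsTilingOn (k s : ℕ) (E : Finset (Finset V)) (U : Finset V) : Prop :=
  ∃ T : Finset (Finset V), IsCsTiling k s E T ∧ T.biUnion id = U

/-- a perfect `C_s^k`-tiling of `H`. -/
def HasPerfectCsTiling (k s : ℕ) (E : Finset (Finset V)) : Prop :=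
  HasPerfectCsTilingOn k s E Finset.univ

/-- the pair `(k,s)` is admissible if `gcd k s = 1` or `k / gcd k s` is even. -/
def AdmissiblePair (k s : ℕ) : Prop := Nat.gcd k s = 1 ∨ Even (k / Nat.gcd k s)

/-- The `k`-graph `H₀^k(A,B)`: edges are the `k`-subsets `e` of `A ∪ B`
with `|e ∩ A| ≢ k (mod 2)`. -/
def H0edges (k : ℕ) (A B : Finset V) : Finset (Finset V) :=
  ((A ∪ B).powersetCard k).filter fun e => ¬ (e ∩ A).card % 2 = k % 2

/-- `P` is (the vertex list of) a tight path: distinct vertices, every `k`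
consecutive vertices form an edge. -/
def IsTightPath (k : ℕ) (E : Finset (Finset V)) (P : List V) : Prop :=
  P.Nodup ∧ ∀ i, i + k ≤ P.length → ((P.drop i).take k).toFinset ∈ E

/-- `P = v₁ ⋯ v_ℓ` has start of type `σ` w.r.t. classes `Vc`: `v_i ∈ V_{σ(i)}`
for `1 ≤ i ≤ k-1` (0-indexed below). -/
def hasStartType (k : ℕ) (Vc : Fin k → Finset V) (P : List V) (σ : Equiv.Perm (Fin k)) : Prop :=
  k ≤ P.length + 1 ∧ ∀ j : Fin k, (j : ℕ) + 1 < k → ∀ v ∈ P[(j : ℕ)]?, v ∈ Vc (σ j)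

/-- `P = v₁ ⋯ v_ℓ` has end of type `σ` w.r.t. classes `Vc`: `v_{ℓ-k+i} ∈ V_{σ(i)}`
for `2 ≤ i ≤ k` (0-indexed below). -/
def hasEndType (k : ℕ) (Vc : Fin k → Finset V) (P : List V) (σ : Equiv.Perm (Fin k)) : Prop :=
  k ≤ P.length + 1 ∧ ∀ j : Fin k, (j : ℕ) ≠ 0 →
    ∀ v ∈ P[(P.length + (j : ℕ) - k)]?, v ∈ Vc (σ j)

/-- `Vc` are the classes of a complete `(k,k)`-graph in `H`: nonempty, pairwise disjoint,
and every transversal is an edge. -/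
def IsCompletePartite (k : ℕ) (E : Finset (Finset V)) (Vc : Fin k → Finset V) : Prop :=
  (∀ i, (Vc i).Nonempty) ∧ (∀ i j, i ≠ j → Disjoint (Vc i) (Vc j)) ∧
  ∀ g : Fin k → V, (∀ i, g i ∈ Vc i) → Finset.image g Finset.univ ∈ E

/-- the cyclic permutation `τ = (1 2 ⋯ k)` (0-indexed: `j ↦ j + 1 mod k`). -/
def cyc (k : ℕ) : Equiv.Perm (Fin k) := finRotate k

/-- `W` is a `G`-gadget for the complete `(k,k)`-graph with classes `Vc` avoiding `S`. -/
def IsGadget (k : ℕ) (E : Finset (Finset V)) (Vc : Fin k → Finset V)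
    (G : SimpleGraph (Fin k)) (S : Finset V) (W : Fin k → Fin k → Finset V) : Prop :=
  (∀ i j, G.Adj i j → W i j = W j i) ∧
  (∀ i j, G.Adj i j →
    (W i j).card = 2 * k - 1 ∧
    (W i j \ Finset.univ.biUnion Vc).card = 1 ∧
    Disjoint (W i j) S ∧
    (∀ i' : Fin k, (W i j ∩ Vc i').card = if i' = i ∨ i' = j then 1 else 2) ∧
    (∀ σ : Equiv.Perm (Fin k), (∃ z : Fin k, (z : ℕ) = 0 ∧ (σ z = i ∨ σ z = j)) →
      ∃ Q : List V, IsTightPath k E Q ∧ Q.toFinset = W i j ∧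
        hasStartType k Vc Q (σ * cyc k) ∧ hasEndType k Vc Q (Equiv.swap i j * σ))) ∧
  (∀ i j i' j', G.Adj i j → G.Adj i' j' → ({i, j} : Finset (Fin k)) ≠ {i', j'} →
    Disjoint (W i j) (W i' j'))

open Classical in
/-- the set of vertices `w_{ij}`, `ij ∈ E(G)`, of a gadget `W`. -/
noncomputable def gadgetVerts (k : ℕ) (Vc : Fin k → Finset V)
    (G : SimpleGraph (Fin k)) (W : Fin k → Fin k → Finset V) : Finset V :=
  (Finset.univ.filter fun p : Fin k × Fin k => G.Adj p.1 p.2).biUnion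
    fun p => W p.1 p.2 \ Finset.univ.biUnion Vc

/-- the graph on `[k]` consisting of the paths given by the lists in `L`. -/
def pathsGraph (k : ℕ) (L : List (List (Fin k))) : SimpleGraph (Fin k) :=
  SimpleGraph.fromEdgeSet {e | ∃ l ∈ L, ∃ p ∈ l.zip l.tail, e = s(p.1, p.2)}

/-- `G` is a vertex-disjoint union of paths. -/
def IsUnionOfPaths (k : ℕ) (G : SimpleGraph (Fin k)) : Prop :=
  ∃ L : List (List (Fin k)), (∀ l ∈ L, l.Nodup) ∧
    L.Pairwise (fun l₁ l₂ => ∀ a ∈ l₁, ∀ b ∈ l₂, a ≠ b) ∧ G = pathsGraph k L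

/-- `m(σ)` (1-indexed), read off from the normalized cycle decomposition `L` of `σ`:
the last element of the last cycle, or `1` if `L` is empty. -/
def mOf (k : ℕ) (L : List (List (Fin k))) : ℕ :=
  ((L.getLast?.bind List.getLast?).map (fun x => (x : ℕ) + 1)).getD 1

/-- `L` is the normalized cycle decomposition of `σ`: disjoint cycles of length ≥ 2,
each cycle listed ending with its minimal element, the cycles ordered by increasing
last elements. -/
def IsNormCycleDecomp (k : ℕ) (σ : Equiv.Perm (Fin k)) (L : List (List (Fin k))) : Prop :=
  (∀ l ∈ L, 2 ≤ l.length ∧ l.Nodup) ∧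
  L.Pairwise (fun l₁ l₂ => ∀ a ∈ l₁, ∀ b ∈ l₂, a ≠ b) ∧
  σ = (L.map List.formPerm).prod ∧
  (∀ l ∈ L, ∀ a ∈ l.getLast?, ∀ b ∈ l, a ≤ b) ∧
  L.Pairwise (fun l₁ l₂ => ∀ a ∈ l₁.getLast?, ∀ b ∈ l₂.getLast?, a < b)

/-- `H` is `(μ, θ)`-dense. -/
def IsDense (k : ℕ) (μ θ : ℝ) (E : Finset (Finset V)) : Prop :=
  ∃ 𝒮 : Finset (Finset V), (∀ S ∈ 𝒮, S.card = k - 1) ∧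
    (𝒮.card : ℝ) ≤ θ * ((Fintype.card V).choose (k - 1)) ∧
    ∀ S : Finset V, S.card = k - 1 → S ∉ 𝒮 →
      μ * ((Fintype.card V : ℝ) - k + 1) ≤ (degS E S : ℝ)

/-- `H` is strongly `(μ, θ)`-dense. -/
def IsStronglyDense (k : ℕ) (μ θ : ℝ) (E : Finset (Finset V)) : Prop :=
  IsDense k μ θ E ∧ ∀ e ∈ E, ∀ X ⊆ e, X.card = k - 1 →
    μ * ((Fintype.card V : ℝ) - k + 1) ≤ (degS E X : ℝ)

/-- the vertex set of `F(K,G)` inside the ambient type: all core vertices, plus one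
pendant vertex for each edge of `G`. -/
def FsVertexSet (k : ℕ) (a : Fin k → ℕ) (G : SimpleGraph (Fin k)) :
    Set ((Σ i : Fin k, Fin (a i)) ⊕ Sym2 (Fin k)) :=
  Set.range Sum.inl ∪ Sum.inr '' G.edgeSet

/-- the edges of `F(K,G)`, where `K = K^k(a)`: all transversals of the classes, plus,
for each edge `ij` of `G`, all `k`-sets consisting of the pendant vertex `w_{ij}` and one
vertex from each class other than `i` (resp. other than `j`). -/
def FKGedges (k : ℕ) (a : Fin k → ℕ) (G : SimpleGraph (Fin k)) :
    Set (Finset ((Σ i : Fin k, Fin (a i)) ⊕ Sym2 (Fin k))) :=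
  {e | (∃ g : ∀ i, Fin (a i), e = Finset.univ.image fun i => Sum.inl ⟨i, g i⟩) ∨
    (∃ i j, G.Adj i j ∧ ∃ g : ∀ i', Fin (a i'),
      e = insert (Sum.inr s(i, j)) ((Finset.univ.erase i).image fun i' => Sum.inl ⟨i', g i'⟩))}

/-- `F(K^k(a), G)` contains a spanning copy of the tight cycle `C_s^k`. -/
def FsHasSpanningCs (k s : ℕ) (a : Fin k → ℕ) (G : SimpleGraph (Fin k)) : Prop :=
  ∃ C : List ((Σ i : Fin k, Fin (a i)) ⊕ Sym2 (Fin k)),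
    C.Nodup ∧ C.length = s ∧ (↑C.toFinset : Set _) = FsVertexSet k a G ∧
    ∀ i < C.length, (((C ++ C).drop i).take k).toFinset ∈ FKGedges k a G

/-- `A` is the vertex set of a copy of `K^k(t)` in `H`. -/
def SpansEsCopy (k t : ℕ) (E : Finset (Finset V)) (A : Finset V) : Prop :=
  ∃ f : Fin k × Fin t → V, Function.Injective f ∧ Finset.univ.image f = A ∧
    ∀ g : Fin k → Fin t, (Finset.univ.image fun i => f (i, g i)) ∈ E

/-- `A` is the vertex set of a copy of `F_s = F(K^k(a), G)` in `H`. -/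
def SpansFsCopy (k : ℕ) (a : Fin k → ℕ) (G : SimpleGraph (Fin k))
    (E : Finset (Finset V)) (A : Finset V) : Prop :=
  ∃ f : ((Σ i : Fin k, Fin (a i)) ⊕ Sym2 (Fin k)) → V,
    Set.InjOn f (FsVertexSet k a G) ∧ f '' FsVertexSet k a G = ↑A ∧
    ∀ e ∈ FKGedges k a G, e.image f ∈ E

/-- `(TF, TE)` is an `{F_s, E_s}`-tiling of `H`, given as the families of vertex sets of
the copies of `F_s` and of `E_s = K^k(max_i a_i)`. -/
def IsFETiling (k : ℕ) (a : Fin k → ℕ) (G : SimpleGraph (Fin k))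
    (E : Finset (Finset V)) (TF TE : Finset (Finset V)) : Prop :=
  ((↑(TF ∪ TE) : Set (Finset V)).PairwiseDisjoint id) ∧
  (∀ A ∈ TF, SpansFsCopy k a G E A) ∧
  (∀ A ∈ TE, SpansEsCopy k (Finset.univ.sup a) E A)

/-- `φ(𝒯) = (n - s(|ℱ_𝒯| + (3/5)|ℰ_𝒯|))/n`. -/
noncomputable def phiTiling (s : ℕ) (TF TE : Finset (Finset V)) : ℝ :=
  ((Fintype.card V : ℝ) - s * ((TF.card : ℝ) + (3 / 5) * (TE.card : ℝ))) / (Fintype.card V : ℝ)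

/-- `φ(H)`: the minimum of `φ(𝒯)` over all `{F_s, E_s}`-tilings of `H`. -/
noncomputable def phiMin (k s : ℕ) (a : Fin k → ℕ) (G : SimpleGraph (Fin k))
    (E : Finset (Finset V)) : ℝ :=
  sInf {x | ∃ TF TE : Finset (Finset V), IsFETiling k a G E TF TE ∧ x = phiTiling s TF TE}

/-- `Φ(n, μ, θ)`: the maximum of `φ(H)` over all `(μ,θ)`-dense `k`-graphs `H` on `n` vertices. -/
noncomputable def PhiMax (k s : ℕ) (a : Fin k → ℕ) (G : SimpleGraph (Fin k))
    (n : ℕ) (μ θ : ℝ) : ℝ :=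
  sSup {x | ∃ E : Finset (Finset (Fin n)), IsKGraph k E ∧ IsDense k μ θ E ∧
    x = phiMin k s a G E}

end Defs

section Sampling

/-- Tail bound for the intersection of a fixed set with a random `m`-subset of `U` containing `S`,
obtained by counting `t`-subsets of the intersection. -/
theorem card_filter_le_card_inter_mul_choose_le {α : Type*} [DecidableEq α] {U S B : Finset α}
    {m t : ℕ} (a : ℕ) (hS : S ⊆ U) (hB : B ⊆ U \ S) (hm : S.card + t ≤ m) :
    ((U.powersetCard m).filter fun R => S ⊆ R ∧ a ≤ (B ∩ R).card).card * a.choose t *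
        (U.card - S.card).choose t ≤
      B.card.choose t * (m - S.card).choose t * ((U.powersetCard m).filter (S ⊆ ·)).card := by
  have hcount : ((U.powersetCard m).filter fun R => S ⊆ R ∧ a ≤ (B ∩ R).card).card * a.choose t ≤
      (B.powersetCard t).card * (U.card - (S.card + t)).choose (m - (S.card + t)) := by
    refine card_mul_le_card_mul (fun R Q => Q ⊆ R) (fun R hR => ?_) (fun Q hQ => ?_)
    · calc a.choose t ≤ (B ∩ R).card.choose t := Nat.choose_le_choose t (mem_filter.1 hR).2.2
        _ = ((B ∩ R).powersetCard t).card := (card_powersetCard _ _).symm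
        _ ≤ _ := card_le_card fun Q hQ => by
          rw [mem_powersetCard, subset_inter_iff] at hQ
          exact mem_filter.2 ⟨mem_powersetCard.2 ⟨hQ.1.1, hQ.2⟩, hQ.1.2⟩
    · obtain ⟨hQB, hQt⟩ := mem_powersetCard.1 hQ
      have hdisj : Disjoint S Q :=
        disjoint_of_subset_right (hQB.trans hB) disjoint_sdiff
      have hcard : (S ∪ Q).card = S.card + t := by rw [card_union_of_disjoint hdisj, hQt]
      rw [← hcard, ← card_filter_powersetCard_subset (S ∪ Q) U m
        (union_subset hS ((hQB.trans hB).trans sdiff_subset)) (hcard ▸ hm)]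
      refine card_le_card fun R hR => ?_
      simp only [mem_bipartiteBelow, mem_filter] at hR
      exact mem_filter.2 ⟨hR.1.1, union_subset hR.1.2.1 hR.2⟩
  have hid := Nat.choose_mul (n := U.card - S.card) (k := m - S.card) (s := t) (by lia)
  rw [card_filter_powersetCard_subset S U m hS (by lia)]
  rw [card_powersetCard, ← Nat.sub_sub, ← Nat.sub_sub] at hcount
  calc _ ≤ B.card.choose t * (U.card - S.card - t).choose (m - S.card - t) *
        (U.card - S.card).choose t := Nat.mul_le_mul_right _ hcount
    _ = B.card.choose t * ((U.card - S.card).choose t *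
        (U.card - S.card - t).choose (m - S.card - t)) := by ring
    _ = _ := by rw [← hid]; ring

theorem choose_mul_choose_le_pow_mul {b w r a t : ℕ} {q : ℝ} (hq : 0 ≤ q) (hbw : b ≤ w)
    (hw : 0 < w) (h : (b : ℝ) * r ≤ q * w * ((a : ℝ) - t)) :
    (b.choose t : ℝ) * r.choose t ≤ q ^ t * ((w.choose t : ℝ) * a.choose t) := by
  have hstep : ∀ i ≤ t, ((b - i : ℕ) : ℝ) * ((r - i : ℕ) : ℝ) ≤
      q * (((w - i : ℕ) : ℝ) * ((a - i : ℕ) : ℝ)) := fun i hi => by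
    have hb : ((b - i : ℕ) : ℝ) * w ≤ b * ((w - i : ℕ) : ℝ) := by
      rcases le_total b i with hbi | hbi
      · rw [Nat.sub_eq_zero_of_le hbi]; simp; positivity
      · have hbw' : (b : ℝ) ≤ w := by exact_mod_cast hbw
        rw [Nat.cast_sub hbi, Nat.cast_sub (hbi.trans hbw)]
        nlinarith [(Nat.cast_nonneg i : (0 : ℝ) ≤ i)]
    have hr : ((r - i : ℕ) : ℝ) ≤ r := by exact_mod_cast Nat.sub_le r i
    have ha : (a : ℝ) - t ≤ ((a - i : ℕ) : ℝ) := by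
      have : (a : ℝ) ≤ ((a - i : ℕ) : ℝ) + t := by exact_mod_cast (by lia : a ≤ a - i + t)
      linarith
    have hw' : (0 : ℝ) < w := by exact_mod_cast hw
    refine le_of_mul_le_mul_right ?_ hw'
    calc ((b - i : ℕ) : ℝ) * ((r - i : ℕ) : ℝ) * w
        = ((b - i : ℕ) : ℝ) * w * ((r - i : ℕ) : ℝ) := by ring
      _ ≤ b * ((w - i : ℕ) : ℝ) * r := by gcongr
      _ = b * r * ((w - i : ℕ) : ℝ) := by ring
      _ ≤ q * w * ((a : ℝ) - t) * ((w - i : ℕ) : ℝ) := by gcongr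
      _ ≤ q * w * ((a - i : ℕ) : ℝ) * ((w - i : ℕ) : ℝ) := by gcongr
      _ = _ := by ring
  have hdesc : ∀ i ≤ t, (b.descFactorial i : ℝ) * r.descFactorial i ≤
      q ^ i * ((w.descFactorial i : ℝ) * a.descFactorial i) := fun i => by
    induction i with
    | zero => simp
    | succ i ih =>
      intro hi
      simp only [Nat.descFactorial_succ, Nat.cast_mul]
      calc _ = ((b - i : ℕ) : ℝ) * ((r - i : ℕ) : ℝ) *
            ((b.descFactorial i : ℝ) * r.descFactorial i) := by ring
        _ ≤ q * (((w - i : ℕ) : ℝ) * ((a - i : ℕ) : ℝ)) *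
            (q ^ i * ((w.descFactorial i : ℝ) * a.descFactorial i)) := by
          exact mul_le_mul (hstep i (by lia)) (ih (by lia)) (by positivity) (by positivity)
        _ = _ := by ring
  have hfac : (0 : ℝ) < (t.factorial : ℝ) * t.factorial := by positivity
  have := hdesc t le_rfl
  simp only [Nat.descFactorial_eq_factorial_mul_choose, Nat.cast_mul] at this
  refine le_of_mul_le_mul_left ?_ hfac
  linarith

theorem card_filter_subset_subset_add_card {V : Type} [DecidableEq V] {k : ℕ}
    {E : Finset (Finset V)} (hE : IsKGraph k E) (hk : 1 ≤ k) {S W : Finset V} (hSW : S ⊆ W)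
    (hS : S.card = k - 1) :
    (E.filter fun e => S ⊆ e ∧ e ⊆ W).card + ((W \ S).filter fun v => insert v S ∉ E).card =
      W.card - (k - 1) := by
  have hcard : (E.filter fun e => S ⊆ e ∧ e ⊆ W).card =
      ((W \ S).filter fun v => insert v S ∈ E).card := by
    symm
    refine card_bij (fun v _ => insert v S) ?_ ?_ ?_
    · intro v hv
      simp only [mem_filter, mem_sdiff] at hv ⊢
      exact ⟨hv.2, subset_insert _ _, insert_subset hv.1.1 hSW⟩
    · intro v hv v' hv' h
      simp only [mem_filter, mem_sdiff] at hv hv'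
      exact (insert_inj hv.1.2).1 h
    · intro e he
      obtain ⟨heE, hSe, heW⟩ := mem_filter.1 he
      have h1 : (e \ S).card = 1 := by
        rw [card_sdiff_of_subset hSe, hE e heE, hS]; lia
      obtain ⟨v, hv⟩ := card_eq_one.1 h1
      have hve : v ∈ e \ S := by simp [hv]
      have hins : insert v S = e := by
        rw [insert_eq, ← hv, sdiff_union_of_subset hSe]
      refine ⟨v, ?_, hins⟩
      simp only [mem_filter, mem_sdiff] at hve ⊢
      exact ⟨⟨heW hve.1, hve.2⟩, hins ▸ heE⟩
  rw [hcard, card_filter_add_card_filter_not, card_sdiff_of_subset hSW, hS]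

/-- Few `m`-sets `R` contain `S \ {x, y}` and have small degree of `S` in `R ∪ {x, y}`. -/
theorem card_filter_degree_lt_le {V : Type} [Fintype V] [DecidableEq V] {k m t : ℕ} {γ : ℝ}
    {E : Finset (Finset V)} (hk : 1 ≤ k) (hγ : 0 < γ) (hγ' : γ < 1 / 2) (hE : IsKGraph k E)
    (hmV : m + 2 ≤ Fintype.card V) (hkm : (k : ℝ) + 1 ≤ γ / 8 * m) (ht : (t : ℝ) ≤ γ / 8 * m)
    {x y : V} (hxy : x ≠ y) {S : Finset V} (hS : S.card = k - 1)
    (hdeg : (1 / 2 + γ) * (Fintype.card V : ℝ) ≤ (degS E S : ℝ)) :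
    ((((univ \ {x, y}).powersetCard m).filter fun R : Finset V =>
        S ⊆ insert x (insert y R) ∧
          ((E.filter fun e => S ⊆ e ∧ e ⊆ insert x (insert y R)).card : ℝ) <
            (1 / 2 + γ / 2) * ((m : ℝ) + 2)).card : ℝ) ≤
      (1 - γ / 4) ^ t * (((univ \ {x, y}).powersetCard m).filter fun R : Finset V =>
        S ⊆ insert x (insert y R)).card := by
  set n := Fintype.card V with hn
  set U : Finset V := univ \ {x, y} with hU
  set S₁ := S \ {x, y} with hS₁
  set B := (U \ S).filter fun v => insert v S ∉ E with hBdef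
  set a := ⌈(1 / 2 - γ / 2) * ((m : ℝ) + 2) - (k + 1)⌉₊ with ha
  have hUcard : U.card = n - 2 := by
    rw [hU, card_sdiff_of_subset (subset_univ _), card_pair hxy, card_univ]
  have hS₁U : S₁ ⊆ U := sdiff_subset_sdiff (subset_univ _) le_rfl
  have hS₁card : S₁.card ≤ k - 1 := hS ▸ card_le_card sdiff_subset
  have hBU : B ⊆ U \ S₁ := (filter_subset _ _).trans (sdiff_subset_sdiff le_rfl sdiff_subset)
  have hsub : ∀ R : Finset V, S ⊆ insert x (insert y R) ↔ S₁ ⊆ R := fun R => by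
    simp only [hS₁, subset_iff, mem_sdiff, mem_insert, mem_singleton]
    grind
  have hmn : (m : ℝ) + 2 ≤ n := by exact_mod_cast hmV
  have hm0 : (0 : ℝ) < m := by
    have : (0 : ℝ) ≤ k := Nat.cast_nonneg k
    by_contra h
    have : γ / 8 * (m : ℝ) ≤ 0 := mul_nonpos_of_nonneg_of_nonpos (by linarith) (not_lt.1 h)
    linarith
  have hk1 : ((k - 1 : ℕ) : ℝ) = k - 1 := by rw [Nat.cast_sub hk]; simp
  have hjr : (S₁.card : ℝ) ≤ k - 1 := by rw [← hk1]; exact_mod_cast hS₁card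
  have hjt : S₁.card + t ≤ m := by
    have : (S₁.card : ℝ) + t ≤ m := by nlinarith
    exact_mod_cast this
  have hdegB : (B.card : ℝ) ≤ (1 / 2 - γ) * n := by
    have h := card_filter_subset_subset_add_card hE hk (subset_univ S) hS
    simp only [subset_univ, and_true] at h
    have h' : B.card + degS E S ≤ n := by
      have : B.card ≤ ((univ \ S).filter fun v => insert v S ∉ E).card :=
        card_le_card (filter_subset_filter _ (sdiff_subset_sdiff (subset_univ _) le_rfl))
      rw [card_univ] at h
      simp only [degS]
      lia
    have h'' : (B.card : ℝ) + degS E S ≤ n := by exact_mod_cast h'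
    linarith
  have hbad : (U.powersetCard m).filter (fun R : Finset V =>
        S ⊆ insert x (insert y R) ∧
          ((E.filter fun e => S ⊆ e ∧ e ⊆ insert x (insert y R)).card : ℝ) <
            (1 / 2 + γ / 2) * ((m : ℝ) + 2)) ⊆
      (U.powersetCard m).filter fun R => S₁ ⊆ R ∧ a ≤ (B ∩ R).card := by
    intro R hR
    obtain ⟨hRm, hSR, hlt⟩ := mem_filter.1 hR
    refine mem_filter.2 ⟨hRm, (hsub R).1 hSR, ?_⟩
    obtain ⟨hRU, hRc⟩ := mem_powersetCard.1 hRm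
    have hx : x ∉ R := fun h => by simpa [hU] using hRU h
    have hy : y ∉ R := fun h => by simpa [hU] using hRU h
    have hW : (insert x (insert y R)).card = m + 2 := by
      rw [card_insert_of_notMem (by simp [hxy, hx]), card_insert_of_notMem hy, hRc]
    have h := card_filter_subset_subset_add_card hE hk hSR hS
    rw [hW] at h
    have hle : ((insert x (insert y R) \ S).filter fun v => insert v S ∉ E).card ≤
        (B ∩ R).card + 2 := by
      have hss : ((insert x (insert y R) \ S).filter fun v => insert v S ∉ E) ⊆
          (B ∩ R) ∪ {x, y} := by
        intro v hv
        simp only [mem_filter, mem_sdiff, mem_insert] at hv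
        simp only [mem_union, mem_inter, hBdef, mem_filter, mem_sdiff, mem_insert, mem_singleton]
        rcases hv.1.1 with h | h | h
        · exact Or.inr (Or.inl h)
        · exact Or.inr (Or.inr h)
        · exact Or.inl ⟨⟨⟨hRU h, hv.1.2⟩, hv.2⟩, h⟩
      calc _ ≤ _ := card_le_card hss
        _ ≤ _ := card_union_le _ _
        _ = _ := by rw [card_pair hxy]
    have hnat : m + 2 ≤ (E.filter fun e => S ⊆ e ∧ e ⊆ insert x (insert y R)).card +
        ((B ∩ R).card + 2) + (k - 1) := by lia
    have hreal : (m : ℝ) + 2 ≤ ((E.filter fun e => S ⊆ e ∧ e ⊆ insert x (insert y R)).card : ℝ) +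
        (((B ∩ R).card : ℝ) + 2) + ((k - 1 : ℕ) : ℝ) := by exact_mod_cast hnat
    rw [hk1] at hreal
    rw [ha, Nat.ceil_le]
    linarith
  have ha' : (1 / 2 - 3 * γ / 4) * m ≤ (a : ℝ) - t := by
    have := Nat.le_ceil ((1 / 2 - γ / 2) * ((m : ℝ) + 2) - (k + 1))
    rw [← ha] at this
    nlinarith
  set w := U.card - S₁.card with hw
  have hwr : (1 - γ / 8) * n ≤ (w : ℝ) := by
    have : n ≤ w + 2 + S₁.card := by lia
    have : (n : ℝ) ≤ w + 2 + S₁.card := by exact_mod_cast this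
    nlinarith
  have hw0 : 0 < w := by
    have : (0 : ℝ) < w := lt_of_lt_of_le (mul_pos (by linarith) (by linarith)) hwr
    exact_mod_cast this
  have hbw : B.card ≤ w := (card_le_card hBU).trans (card_sdiff_of_subset hS₁U).le
  have hq0 : 0 ≤ 1 - γ / 4 := by linarith
  have hmul : (B.card : ℝ) * (m - S₁.card : ℕ) ≤ (1 - γ / 4) * w * ((a : ℝ) - t) := by
    have hc : 1 / 2 - γ ≤ (1 - γ / 4) * (1 - γ / 8) * (1 / 2 - 3 * γ / 4) := by
      nlinarith [mul_pos hγ hγ, mul_pos (mul_pos hγ hγ) (sub_pos.2 hγ')]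
    have hpos : 0 ≤ 1 / 2 - 3 * γ / 4 := by linarith
    have hn0 : (0 : ℝ) ≤ n := Nat.cast_nonneg n
    have hmj : ((m - S₁.card : ℕ) : ℝ) ≤ m := by exact_mod_cast Nat.sub_le _ _
    calc (B.card : ℝ) * (m - S₁.card : ℕ) ≤ (1 / 2 - γ) * n * m := by
          gcongr
      _ ≤ (1 - γ / 4) * (1 - γ / 8) * (1 / 2 - 3 * γ / 4) * n * m := by gcongr
      _ = (1 - γ / 4) * ((1 - γ / 8) * n) * ((1 / 2 - 3 * γ / 4) * m) := by ring
      _ ≤ _ := by gcongr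
  have hta : t ≤ a := by
    have : (t : ℝ) ≤ a := by
      have : 0 ≤ (1 / 2 - 3 * γ / 4) * (m : ℝ) := mul_nonneg (by linarith) hm0.le
      linarith
    exact_mod_cast this
  have htw : t ≤ w := by
    have : (t : ℝ) ≤ w := by nlinarith
    exact_mod_cast this
  have hratio := choose_mul_choose_le_pow_mul (t := t) hq0 hbw hw0 hmul
  have htail := card_filter_le_card_inter_mul_choose_le (t := t) (m := m) a hS₁U hBU hjt
  simp only [hsub] at hbad ⊢
  have hpos : (0 : ℝ) < (w.choose t : ℝ) * a.choose t :=
    mul_pos (by exact_mod_cast Nat.choose_pos htw) (by exact_mod_cast Nat.choose_pos hta)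
  refine (Nat.cast_le.2 (card_le_card hbad)).trans (le_of_mul_le_mul_right ?_ hpos)
  have htail' : (((U.powersetCard m).filter fun R => S₁ ⊆ R ∧ a ≤ (B ∩ R).card).card : ℝ) *
      a.choose t * w.choose t ≤ (B.card.choose t : ℝ) * (m - S₁.card).choose t *
        ((U.powersetCard m).filter (S₁ ⊆ ·)).card := by exact_mod_cast htail
  calc _ = (((U.powersetCard m).filter fun R => S₁ ⊆ R ∧ a ≤ (B ∩ R).card).card : ℝ) *
      a.choose t * w.choose t := by ring
    _ ≤ _ := htail'
    _ ≤ (1 - γ / 4) ^ t * ((w.choose t : ℝ) * a.choose t) *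
        ((U.powersetCard m).filter (S₁ ⊆ ·)).card := by gcongr
    _ = _ := by ring

theorem exists_forall_pow_mul_pow_le_half (d N : ℕ) (hN : 0 < N) {q : ℝ} (hq : 0 < q)
    (hq' : q < 1) :
    ∃ m₀ : ℕ, ∀ m ≥ m₀, ((m : ℝ) + 2) ^ d * q ^ (m / N) ≤ 1 / 2 := by
  have hlim := tendsto_pow_const_mul_const_pow_of_lt_one d hq.le hq'
  have hε : (0 : ℝ) < q / (2 * (3 * N) ^ d) := by positivity
  obtain ⟨T, hT⟩ := Filter.eventually_atTop.1 (hlim.eventually_le_const hε)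
  refine ⟨N * T, fun m hm => ?_⟩
  have hTm : T ≤ m / N := (Nat.le_div_iff_mul_le hN).2 (by lia)
  have h := hT (m / N + 1) (by lia)
  have hm3 : (m : ℝ) + 2 ≤ 3 * N * ((m / N + 1 : ℕ) : ℝ) := by
    have : m < N * (m / N + 1) := Nat.lt_mul_div_succ m hN
    have : m + 2 ≤ 3 * N * (m / N + 1) := by nlinarith
    exact_mod_cast this
  have hN0 : (0 : ℝ) < N := by exact_mod_cast hN
  calc ((m : ℝ) + 2) ^ d * q ^ (m / N)
      ≤ (3 * N * ((m / N + 1 : ℕ) : ℝ)) ^ d * q ^ (m / N) := by gcongr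
    _ = (3 * N) ^ d / q * (((m / N + 1 : ℕ) : ℝ) ^ d * q ^ (m / N + 1)) := by
      rw [mul_pow, pow_succ]; field_simp
    _ ≤ (3 * N) ^ d / q * (q / (2 * (3 * N) ^ d)) := by gcongr
    _ = 1 / 2 := by field_simp

theorem sum_card_filter_subset_insert_insert {V : Type} [Fintype V] [DecidableEq V] (d m : ℕ)
    {x y : V} (hxy : x ≠ y) :
    ∑ S ∈ (univ : Finset V).powersetCard d,
        (((univ \ {x, y}).powersetCard m).filter fun R : Finset V =>
          S ⊆ insert x (insert y R)).card =
      (Fintype.card V - 2).choose m * (m + 2).choose d := by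
  have h := sum_card_bipartiteAbove_eq_sum_card_bipartiteBelow
    (s := (univ : Finset V).powersetCard d) (t := ((univ : Finset V) \ {x, y}).powersetCard m)
    (fun S R => S ⊆ insert x (insert y R))
  simp only [bipartiteAbove, bipartiteBelow] at h
  rw [h, sum_congr rfl (g := fun _ => (m + 2).choose d), sum_const, card_powersetCard,
    card_sdiff_of_subset (subset_univ _), card_pair hxy, card_univ, smul_eq_mul]
  intro R hR
  obtain ⟨hRU, hRc⟩ := mem_powersetCard.1 hR
  have hx : x ∉ R := fun h => by simpa using hRU h
  have hy : y ∉ R := fun h => by simpa using hRU h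
  have hW : (insert x (insert y R)).card = m + 2 := by
    rw [card_insert_of_notMem (by simp [hxy, hx]), card_insert_of_notMem hy, hRc]
  rw [← hW, ← card_powersetCard]
  congr 1
  ext S
  simp [mem_powersetCard, and_comm]

end Sampling

open Classical in
/-- in a `k`-graph with minimum codegree at least `(1/2 + γ)n`, for distinct
vertices `x, y`, at least half of the `m`-sets `R ⊆ V(H) ∖ {x,y}` satisfy
`δ_{k-1}(H[R ∪ {x,y}]) ≥ (1/2 + γ/2)(m+2)`. -/
theorem hypergeometric_sets (k : ℕ) (hk : 3 ≤ k) (γ : ℝ) (hγ : 0 < γ) :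
    ∃ m₀ : ℕ, ∀ m : ℕ, m₀ ≤ m →
      ∀ (V : Type) [Fintype V] [DecidableEq V] (E : Finset (Finset V)),
        IsKGraph k E → m ≤ Fintype.card V →
        (∀ S : Finset V, S.card = k - 1 →
          (1 / 2 + γ) * (Fintype.card V : ℝ) ≤ (degS E S : ℝ)) →
        ∀ x y : V, x ≠ y →
          ((Fintype.card V - 2).choose m : ℝ) / 2 ≤
            ((((Finset.univ \ {x, y}).powersetCard m).filter fun R : Finset V =>
              ∀ S : Finset V, S ⊆ insert x (insert y R) → S.card = k - 1 →
                (1 / 2 + γ / 2) * ((m : ℝ) + 2) ≤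
                  ((E.filter fun e => S ⊆ e ∧ e ⊆ insert x (insert y R)).card : ℝ)).card : ℝ) := by
  set N := ⌈8 / γ⌉₊ with hN
  have hN8 : 8 ≤ γ * N := by
    have := Nat.le_ceil (8 / γ)
    rw [← hN, div_le_iff₀ hγ] at this
    linarith
  have hN0 : 0 < N := Nat.ceil_pos.2 (by positivity)
  have hm₁ : ∃ m₁ : ℕ, γ < 1 / 2 → ∀ m ≥ m₁,
      ((m : ℝ) + 2) ^ (k - 1) * (1 - γ / 4) ^ (m / N) ≤ 1 / 2 := by
    by_cases h : γ < 1 / 2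
    · obtain ⟨m₁, h₁⟩ := exists_forall_pow_mul_pow_le_half (k - 1) N hN0 (q := 1 - γ / 4)
        (by linarith) (by linarith)
      exact ⟨m₁, fun _ => h₁⟩
    · exact ⟨0, fun h' => absurd h' h⟩
  obtain ⟨m₁, hm₁⟩ := hm₁
  refine ⟨max m₁ (max k (N * (k + 1))), fun m hm V _ _ E hE hmV hdeg x y hxy => ?_⟩
  simp only [max_le_iff] at hm
  obtain ⟨hm₁m, hkm, hNm⟩ := hm
  rcases lt_or_ge (Fintype.card V - 2) m with hsmall | hlarge
  · rw [Nat.choose_eq_zero_of_lt hsmall]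
    simp
  have hn2 : 2 ≤ Fintype.card V := by
    rw [← card_pair hxy]; exact card_le_univ _
  have hγ' : γ < 1 / 2 := by
    by_contra hcon
    obtain ⟨S, -, hS⟩ := exists_subset_card_eq (s := (univ : Finset V)) (n := k - 1)
      (by rw [card_univ]; lia)
    have h := card_filter_subset_subset_add_card hE (by lia) (subset_univ S) hS
    simp only [subset_univ, and_true, card_univ] at h
    have hlt : degS E S < Fintype.card V := by
      simp only [degS]; lia
    have hlt' : (degS E S : ℝ) < Fintype.card V := by exact_mod_cast hlt
    have := hdeg S hS
    nlinarith [(Nat.cast_nonneg (Fintype.card V) : (0 : ℝ) ≤ Fintype.card V)]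
  have hkm' : (k : ℝ) + 1 ≤ γ / 8 * m := by
    have : (N : ℝ) * (k + 1) ≤ m := by exact_mod_cast hNm
    have hk0 : (0 : ℝ) ≤ k := Nat.cast_nonneg k
    nlinarith
  have ht : ((m / N : ℕ) : ℝ) ≤ γ / 8 * m := by
    have h : ((m / N : ℕ) : ℝ) * N ≤ m := by exact_mod_cast Nat.div_mul_le_self m N
    have h0 : (0 : ℝ) ≤ ((m / N : ℕ) : ℝ) := Nat.cast_nonneg _
    nlinarith
  set U : Finset V := univ \ {x, y} with hU
  set P : Finset V → Prop := fun R => ∀ S : Finset V, S ⊆ insert x (insert y R) → S.card = k - 1 →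
    (1 / 2 + γ / 2) * ((m : ℝ) + 2) ≤
      ((E.filter fun e => S ⊆ e ∧ e ⊆ insert x (insert y R)).card : ℝ) with hP
  have htotal : ((U.powersetCard m).filter P).card +
      ((U.powersetCard m).filter fun R => ¬ P R).card = (Fintype.card V - 2).choose m := by
    rw [card_filter_add_card_filter_not, card_powersetCard, hU,
      card_sdiff_of_subset (subset_univ _), card_pair hxy, card_univ]
  have hbad : (((U.powersetCard m).filter fun R => ¬ P R).card : ℝ) ≤
      ((Fintype.card V - 2).choose m : ℝ) / 2 := by
    have hcover : ((U.powersetCard m).filter fun R => ¬ P R) ⊆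
        ((univ : Finset V).powersetCard (k - 1)).biUnion fun S =>
          (U.powersetCard m).filter fun R : Finset V =>
            S ⊆ insert x (insert y R) ∧
              ((E.filter fun e => S ⊆ e ∧ e ⊆ insert x (insert y R)).card : ℝ) <
                (1 / 2 + γ / 2) * ((m : ℝ) + 2) := by
      intro R hR
      obtain ⟨hRm, hRP⟩ := mem_filter.1 hR
      simp only [hP, not_forall, not_le] at hRP
      obtain ⟨S, hSR, hS, hlt⟩ := hRP
      exact mem_biUnion.2 ⟨S, mem_powersetCard.2 ⟨subset_univ _, hS⟩,
        mem_filter.2 ⟨hRm, hSR, hlt⟩⟩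
    have hchoose : ((m + 2).choose (k - 1) : ℝ) ≤ ((m : ℝ) + 2) ^ (k - 1) := by
      exact_mod_cast Nat.choose_le_pow (m + 2) (k - 1)
    have hq0 : (0 : ℝ) ≤ 1 - γ / 4 := by linarith
    calc (((U.powersetCard m).filter fun R => ¬ P R).card : ℝ)
        ≤ ∑ S ∈ (univ : Finset V).powersetCard (k - 1),
          (((U.powersetCard m).filter fun R : Finset V =>
            S ⊆ insert x (insert y R) ∧
              ((E.filter fun e => S ⊆ e ∧ e ⊆ insert x (insert y R)).card : ℝ) <
                (1 / 2 + γ / 2) * ((m : ℝ) + 2)).card : ℝ) := by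
          exact_mod_cast (card_le_card hcover).trans card_biUnion_le
      _ ≤ ∑ S ∈ (univ : Finset V).powersetCard (k - 1), (1 - γ / 4) ^ (m / N) *
          (((U.powersetCard m).filter fun R : Finset V =>
            S ⊆ insert x (insert y R)).card : ℝ) := by
          refine sum_le_sum fun S hS => ?_
          have hSc := (mem_powersetCard.1 hS).2
          convert card_filter_degree_lt_le (by lia) hγ hγ' hE (by lia) hkm' ht hxy hSc
            (hdeg S hSc)
      _ = (1 - γ / 4) ^ (m / N) *
          (((Fintype.card V - 2).choose m : ℝ) * (m + 2).choose (k - 1)) := by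
          rw [← mul_sum]
          congr 1
          exact_mod_cast sum_card_filter_subset_insert_insert (k - 1) m hxy
      _ ≤ (1 - γ / 4) ^ (m / N) *
          (((Fintype.card V - 2).choose m : ℝ) * ((m : ℝ) + 2) ^ (k - 1)) := by gcongr
      _ = ((Fintype.card V - 2).choose m : ℝ) *
          (((m : ℝ) + 2) ^ (k - 1) * (1 - γ / 4) ^ (m / N)) := by ring
      _ ≤ ((Fintype.card V - 2).choose m : ℝ) * (1 / 2) := by
          gcongr
          exact hm₁ hγ' m hm₁m
      _ = _ := by ring
  have htotal' : (((U.powersetCard m).filter P).card : ℝ) +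
      ((U.powersetCard m).filter fun R => ¬ P R).card = (Fintype.card V - 2).choose m := by
    exact_mod_cast htotal
  linarith
end

section
/- Let k ≥ 3 and s ≥ 5k² be integers. For every γ > 0 there exists μ₀ > 0 such that for every 0 < μ ≤ μ₀ there exists α₀ > 0 such that for every 0 < α ≤ α₀ there exists n₀ with the following property for all n ≥ n₀. Let H be a k-graph on n vertices with δ_{k−1}(H) ≥ (1/2 + γ)n. Then there exists U ⊆ V(H) with |U| ≤ μn and |U| ≡ 0 (mod s) such that for every W ⊆ V(H) ∖ U with |W| ≤ αn and |W| ≡ 0 (mod s), the induced subgraph H[U ∪ W] has a perfect C_s^k-tiling. -/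
set_option autoImplicit false

open Finset

lemma card_mul_mean_pow_le_sum_pow {ι : Type} [Fintype ι] [Nonempty ι] (g : ι → ℝ)
    (hg : ∀ i, 0 ≤ g i) (B : ℕ) :
    (Fintype.card ι : ℝ) * ((∑ i, g i) / Fintype.card ι) ^ B ≤ ∑ i, g i ^ B := by
  have hpos : (0 : ℝ) < Fintype.card ι := by exact_mod_cast Fintype.card_pos
  rcases B with _ | B
  · simp
  · have := pow_sum_div_card_le_sum_pow (s := univ) (f := g) (fun i _ => hg i) B
    rw [card_univ] at this
    refine le_trans (le_of_eq ?_) this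
    rw [div_pow]
    field_simp
    ring

/-- Counting version of the box theorem: a weight function on `V ^ f` has, in its `b`-fold
blow-up, at least the weight of a constant function with the same mean. -/
lemma mean_pow_le_sum_blowup {V : Type} [Fintype V] [Nonempty V] (b : ℕ) :
    ∀ (f : ℕ) (T : (Fin f → V) → ℝ), (∀ t, 0 ≤ T t) →
      (Fintype.card V : ℝ) ^ (f * b) * ((∑ t, T t) / (Fintype.card V : ℝ) ^ f) ^ (b ^ f) ≤
        ∑ u : Fin f → Fin b → V, ∏ j : Fin f → Fin b, T fun i => u i (j i)
  | 0, T, _ => by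
    simp only [Nat.zero_mul, pow_zero, Fintype.sum_unique, Fintype.prod_unique, pow_one, one_mul,
      div_one]
    exact le_of_eq (congrArg T (Subsingleton.elim _ _))
  | f + 1, T, hT => by
    have hn : (0 : ℝ) < Fintype.card V := by exact_mod_cast Fintype.card_pos
    set n : ℝ := (Fintype.card V : ℝ) with hn_def
    let Ta : (Fin b → V) → (Fin f → V) → ℝ := fun a t => ∏ l, T (Fin.cons (a l) t)
    have hTa : ∀ a t, 0 ≤ Ta a t := fun a t => prod_nonneg fun l _ => hT _
    have split : ∑ u : Fin (f + 1) → Fin b → V, ∏ j : Fin (f + 1) → Fin b,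
        T (fun i => u i (j i)) =
        ∑ a : Fin b → V, ∑ u : Fin f → Fin b → V, ∏ j : Fin f → Fin b,
          Ta a fun i => u i (j i) := by
      rw [← Fintype.sum_prod_type',
        ← Equiv.sum_comp (Fin.consEquiv fun _ : Fin (f + 1) => Fin b → V)]
      refine sum_congr rfl fun p _ => ?_
      rw [← Equiv.prod_comp (Fin.consEquiv fun _ : Fin (f + 1) => Fin b),
        Fintype.prod_prod_type, prod_comm]
      refine prod_congr rfl fun j _ => prod_congr rfl fun l _ => congrArg T ?_
      funext i
      refine Fin.cases ?_ (fun i => ?_) i <;> simp [Fin.consEquiv]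
    have sumTa : ∑ a, ∑ t, Ta a t = ∑ t : Fin f → V, (∑ v, T (Fin.cons v t)) ^ b := by
      rw [sum_comm]
      refine sum_congr rfl fun t _ => ?_
      rw [Fintype.sum_pow]
    have sumT : ∑ t, T t = ∑ t : Fin f → V, ∑ v, T (Fin.cons v t) := by
      rw [← Equiv.sum_comp (Fin.consEquiv fun _ : Fin (f + 1) => V), Fintype.sum_prod_type,
        sum_comm]
      rfl
    have h1 : n ^ f * ((∑ t, T t) / n ^ f) ^ b ≤ ∑ a, ∑ t, Ta a t := by
      rw [sumTa, sumT]
      have := card_mul_mean_pow_le_sum_pow (fun t : Fin f → V => ∑ v, T (Fin.cons v t))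
        (fun t => sum_nonneg fun v _ => hT _) b
      simpa using this
    have h2 : n ^ b * ((∑ a, (∑ t, Ta a t) / n ^ f) / n ^ b) ^ b ^ f ≤
        ∑ a, ((∑ t, Ta a t) / n ^ f) ^ b ^ f := by
      have := card_mul_mean_pow_le_sum_pow (fun a : Fin b → V => (∑ t, Ta a t) / n ^ f)
        (fun a => div_nonneg (sum_nonneg fun t _ => hTa a t) (by positivity)) (b ^ f)
      simpa using this
    have h0 : 0 ≤ ∑ t, T t := sum_nonneg fun t _ => hT t
    have h3 : ((∑ t, T t) / n ^ (f + 1)) ^ b ≤ (∑ a, (∑ t, Ta a t) / n ^ f) / n ^ b := by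
      rw [← sum_div, div_div, le_div_iff₀ (by positivity)]
      refine le_trans (le_of_eq ?_) h1
      rw [pow_succ, ← div_div, div_pow _ n]
      field_simp
    rw [split]
    calc n ^ ((f + 1) * b) * ((∑ t, T t) / n ^ (f + 1)) ^ b ^ (f + 1)
        = n ^ (f * b) * (n ^ b * (((∑ t, T t) / n ^ (f + 1)) ^ b) ^ b ^ f) := by
          rw [← pow_mul _ b, ← pow_succ', add_mul, one_mul, pow_add, mul_assoc]
      _ ≤ n ^ (f * b) * (n ^ b * ((∑ a, (∑ t, Ta a t) / n ^ f) / n ^ b) ^ b ^ f) := by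
          gcongr
      _ ≤ n ^ (f * b) * ∑ a, ((∑ t, Ta a t) / n ^ f) ^ b ^ f := by gcongr
      _ ≤ _ := by
          rw [mul_sum]
          exact sum_le_sum fun a _ => mean_pow_le_sum_blowup b f (Ta a) (hTa a)

lemma card_mul_card_le_of_determined {ι V : Type} [Fintype ι] [DecidableEq ι] [Fintype V]
    [DecidableEq V] (S : Finset (ι → V)) (i : ι)
    (h : ∀ g ∈ S, ∀ g' ∈ S, (∀ l, l ≠ i → g l = g' l) → g = g') :
    S.card * Fintype.card V ≤ Fintype.card V ^ Fintype.card ι := by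
  rw [← Fintype.card_fun, ← card_univ (α := V), ← card_product, ← card_univ]
  refine card_le_card_of_injOn (fun p => Function.update p.1 i p.2) (fun _ _ => mem_univ _) ?_
  rintro ⟨g, v⟩ hg ⟨g', v'⟩ hg' he
  simp only [coe_product, Set.mem_prod, mem_coe] at hg hg'
  have hv : v = v' := by simpa using congrFun he i
  refine Prod.ext (h g hg.1 g' hg'.1 fun l hl => ?_) hv
  simpa [hl] using congrFun he l

/-- Few functions fail to be injective or meet a given small set. -/
lemma card_not_injective_or_meets_mul_le {ι V : Type} [Fintype ι] [DecidableEq ι] [Fintype V]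
    (F : Finset V)
    [DecidablePred fun g : ι → V => ¬(Function.Injective g ∧ ∀ i, g i ∉ F)] :
    (univ.filter fun g : ι → V => ¬(Function.Injective g ∧ ∀ i, g i ∉ F)).card *
      Fintype.card V ≤
      (Fintype.card ι ^ 2 + Fintype.card ι * F.card) * Fintype.card V ^ Fintype.card ι := by
  classical
  have hsub : (univ.filter fun g : ι → V => ¬(Function.Injective g ∧ ∀ i, g i ∉ F)) ⊆
      (univ.biUnion fun p : ι × ι => univ.filter fun g : ι → V => p.1 ≠ p.2 ∧ g p.1 = g p.2) ∪
      ((univ ×ˢ F).biUnion fun p : ι × V => univ.filter fun g : ι → V => g p.1 = p.2) := by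
    intro g hg
    simp only [mem_filter, mem_univ, true_and, not_and_or, not_forall, not_not,
      Function.Injective] at hg
    simp only [mem_union, mem_biUnion, mem_filter, mem_univ, true_and, mem_product]
    rcases hg with ⟨i, j, h, hij⟩ | ⟨i, h⟩
    · exact Or.inl ⟨(i, j), hij, h⟩
    · exact Or.inr ⟨(i, g i), h, rfl⟩
  have h1 : ∀ p : ι × ι, (univ.filter fun g : ι → V => p.1 ≠ p.2 ∧ g p.1 = g p.2).card *
      Fintype.card V ≤ Fintype.card V ^ Fintype.card ι := by
    intro p
    refine card_mul_card_le_of_determined _ p.1 fun g hg g' hg' h => ?_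
    simp only [mem_filter, mem_univ, true_and] at hg hg'
    funext l
    by_cases hl : l = p.1
    · rw [hl, hg.2, hg'.2, h _ hg.1.symm]
    · exact h l hl
  have h2 : ∀ p : ι × V, (univ.filter fun g : ι → V => g p.1 = p.2).card *
      Fintype.card V ≤ Fintype.card V ^ Fintype.card ι := by
    intro p
    refine card_mul_card_le_of_determined _ p.1 fun g hg g' hg' h => ?_
    simp only [mem_filter, mem_univ, true_and] at hg hg'
    funext l
    by_cases hl : l = p.1
    · rw [hl, hg, hg']
    · exact h l hl
  calc _ ≤ ((∑ p : ι × ι, (univ.filter fun g : ι → V => p.1 ≠ p.2 ∧ g p.1 = g p.2).card) +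
        ∑ p ∈ univ ×ˢ F, (univ.filter fun g : ι → V => g p.1 = p.2).card) * Fintype.card V := by
        refine Nat.mul_le_mul_right _ ((card_le_card hsub).trans ((card_union_le _ _).trans ?_))
        exact add_le_add card_biUnion_le card_biUnion_le
    _ ≤ _ := by
        rw [add_mul, add_mul, sum_mul, sum_mul]
        refine add_le_add ((sum_le_sum fun p _ => h1 p).trans (le_of_eq ?_))
          ((sum_le_sum fun p _ => h2 p).trans (le_of_eq ?_))
        · simp [sq]
        · simp

lemma card_filter_le_card_filter_comp {I J V : Type} [Fintype I] [DecidableEq I]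
    [Fintype J] [DecidableEq J] [Fintype V]
    {φ : J → I} (hφ : Function.Injective φ) (P : (I → V) → Prop) (Q : (J → V) → Prop)
    [DecidablePred P] [DecidablePred Q] (h : ∀ u, P u → Q (u ∘ φ)) :
    (univ.filter P).card ≤
      (univ.filter Q).card * Fintype.card V ^ (Fintype.card I - Fintype.card J) := by
  classical
  have hc : Fintype.card {i // i ∉ Set.range φ} = Fintype.card I - Fintype.card J := by
    rw [Fintype.card_subtype_compl, ← Set.card_range_of_injective hφ]
  rw [← hc, ← Fintype.card_fun, ← card_univ, ← card_product]
  refine card_le_card_of_injOn (fun u => (u ∘ φ, fun i => u i)) (fun u hu => ?_) ?_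
  · simpa using h u (by simpa using hu)
  · intro u _ u' _ he
    rw [Prod.mk.injEq] at he
    funext i
    by_cases hi : i ∈ Set.range φ
    · obtain ⟨j, rfl⟩ := hi
      exact congrFun he.1 j
    · exact congrFun he.2 ⟨i, hi⟩

/-- Counting version of the box theorem for a property of functions on a finite type. -/
lemma card_blowup_ge {ι V : Type} [Fintype ι] [DecidableEq ι] [Fintype V] [Nonempty V] (b : ℕ)
    (P : (ι → V) → Prop) [DecidablePred P]
    [DecidablePred fun u : ι × Fin b → V => ∀ j : ι → Fin b, P fun i => u (i, j i)]
    {c : ℝ} (hc : 0 ≤ c)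
    (h : c * (Fintype.card V : ℝ) ^ Fintype.card ι ≤ ((univ.filter P).card : ℝ)) :
    c ^ (b ^ Fintype.card ι) * (Fintype.card V : ℝ) ^ (Fintype.card ι * b) ≤
      ((univ.filter fun u : ι × Fin b → V =>
        ∀ j : ι → Fin b, P fun i => u (i, j i)).card : ℝ) := by
  have hn : (0 : ℝ) < Fintype.card V := by exact_mod_cast Fintype.card_pos
  let e := Fintype.equivFin ι
  let T : (Fin (Fintype.card ι) → V) → ℝ := fun t => if P (t ∘ e) then 1 else 0
  have hT : ∀ t, 0 ≤ T t := fun t => by simp only [T]; split_ifs <;> norm_num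
  have hsum : ∑ t, T t = ((univ.filter P).card : ℝ) := by
    rw [← Finset.sum_boole]
    exact Fintype.sum_equiv (e.arrowCongr (Equiv.refl V)).symm _ _ fun t => rfl
  have key := mean_pow_le_sum_blowup b _ T hT
  have hsum' : ∑ u : Fin (Fintype.card ι) → Fin b → V, ∏ j : Fin (Fintype.card ι) → Fin b,
      T (fun i => u i (j i)) = ((univ.filter fun u : ι × Fin b → V =>
        ∀ j : ι → Fin b, P fun i => u (i, j i)).card : ℝ) := by
    rw [← Finset.sum_boole]
    refine Fintype.sum_equiv ((e.arrowCongr (Equiv.refl (Fin b → V))).symm.trans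
      (Equiv.curry ι (Fin b) V).symm) _ _ fun u => ?_
    simp only [T, Finset.prod_boole, mem_univ, true_implies]
    refine if_congr ⟨fun H j => ?_, fun H j => ?_⟩ rfl rfl
    · have := H (j ∘ e.symm)
      convert this using 1
      funext i
      simp [Equiv.arrowCongr, Function.uncurry]
    · have := H (j ∘ e)
      convert this using 1
      funext i
      simp [Equiv.arrowCongr, Function.uncurry]
  rw [hsum, hsum'] at key
  refine le_trans ?_ key
  rw [mul_comm]
  have : c ≤ ((univ.filter P).card : ℝ) / (Fintype.card V : ℝ) ^ Fintype.card ι := by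
    rwa [le_div_iff₀ (by positivity)]
  gcongr
/-- The vertices of the seed: the `k` vertices of a base edge, and a pendant vertex for each
pair of base vertices. -/
abbrev SeedVertex (k : ℕ) : Type := Fin k ⊕ (Fin k × Fin k)

/-- The edges of the seed: the base edge, and the edges obtained from it by exchanging one of the
base vertices `i`, `j` for the pendant vertex of the pair `(i, j)`. -/
def IsSeedEdge (k : ℕ) (e : Finset (SeedVertex k)) : Prop :=
  e = univ.image Sum.inl ∨ ∃ i j : Fin k,
    e = insert (Sum.inr (i, j)) ((univ.erase i).image Sum.inl) ∨
    e = insert (Sum.inr (i, j)) ((univ.erase j).image Sum.inl)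

lemma IsSeedEdge.card_eq {k : ℕ} {e : Finset (SeedVertex k)} (h : IsSeedEdge k e) :
    e.card = k := by
  have key : ∀ (p : Fin k × Fin k) (l : Fin k),
      (insert (Sum.inr p) ((univ.erase l).image Sum.inl) : Finset (SeedVertex k)).card = k := by
    intro p l
    rw [card_insert_of_notMem (by simp), card_image_of_injective _ Sum.inl_injective,
      card_erase_of_mem (mem_univ l), card_univ, Fintype.card_fin]
    have := l.pos
    omega
  rcases h with rfl | ⟨i, j, rfl | rfl⟩
  · rw [card_image_of_injective _ Sum.inl_injective, card_univ, Fintype.card_fin]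
  · exact key _ _
  · exact key _ _

/-- Rounds `A` and `B` can follow each other in a walk on the seed. -/
def RoundsCompat (k : ℕ) (A B : Fin k → SeedVertex k) : Prop :=
  ∀ c : ℕ, IsSeedEdge k (univ.image fun j : Fin k => if (j : ℕ) < c then B j else A j)

lemma image_inl_perm {k : ℕ} (σ : Equiv.Perm (Fin k)) :
    univ.image (fun j => (Sum.inl (σ j) : SeedVertex k)) = univ.image Sum.inl := by
  ext e
  simp only [mem_image, mem_univ, true_and]
  constructor
  · rintro ⟨a, rfl⟩; exact ⟨_, rfl⟩
  · rintro ⟨a, rfl⟩; exact ⟨σ.symm a, by simp⟩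

lemma roundsCompat_perm {k : ℕ} (σ : Equiv.Perm (Fin k)) :
    RoundsCompat k (fun j => Sum.inl (σ j)) (fun j => Sum.inl (σ j)) := by
  intro c
  left
  simp only [ite_self]
  exact image_inl_perm σ

lemma exists_round_between_swap {k : ℕ} (σ : Equiv.Perm (Fin k)) (p q : Fin k) :
    ∃ M : Fin k → SeedVertex k, RoundsCompat k (fun j => Sum.inl (σ j)) M ∧
      RoundsCompat k M (fun j => Sum.inl ((σ * Equiv.swap p q) j)) := by
  wlog hpq : p < q generalizing p q
  · rcases (not_lt.1 hpq).eq_or_lt with rfl | h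
    · exact ⟨_, roundsCompat_perm σ, by simpa using roundsCompat_perm σ⟩
    · rw [Equiv.swap_comm]; exact this q p h
  let M : Fin k → SeedVertex k := fun j =>
    if j = p then Sum.inr (σ p, σ q) else if j = q then Sum.inl (σ p) else Sum.inl (σ j)
  have hM : IsSeedEdge k (univ.image M) := by
    refine Or.inr ⟨σ p, σ q, Or.inr ?_⟩
    ext e
    simp only [mem_image, mem_univ, true_and, mem_insert, mem_erase, M]
    constructor
    · rintro ⟨j, rfl⟩
      by_cases h1 : j = p
      · simp [h1]
      · by_cases h2 : j = q
        · simp [h2, hpq.ne', hpq.ne]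
        · simp [h1, h2]
    · rintro (rfl | ⟨a, ⟨ha, -⟩, rfl⟩)
      · exact ⟨p, by simp⟩
      · by_cases h : a = σ p
        · exact ⟨q, by simp [h, hpq.ne']⟩
        · refine ⟨σ.symm a, ?_⟩
          have h1 : σ.symm a ≠ p := fun h' => h (by rw [← h']; simp)
          have h2 : σ.symm a ≠ q := fun h' => ha (by rw [← h']; simp)
          simp [h1, h2]
  have hbase : ∀ τ : Equiv.Perm (Fin k), IsSeedEdge k (univ.image fun j => Sum.inl (τ j)) :=
    fun τ => Or.inl (image_inl_perm τ)
  refine ⟨M, fun c => ?_, fun c => ?_⟩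
  · rcases le_or_gt c p with hc | hc
    · convert hbase σ using 3 with j
      split_ifs with h
      · have h1 : j ≠ p := fun h' => by subst h'; omega
        have h2 : j ≠ q := fun h' => by subst h'; omega
        simp [M, h1, h2]
      · rfl
    · rcases le_or_gt c q with hc' | hc'
      · refine Or.inr ⟨σ p, σ q, Or.inl ?_⟩
        have hf : (fun j : Fin k => if (j : ℕ) < c then M j else Sum.inl (σ j)) =
            fun j => if j = p then Sum.inr (σ p, σ q) else Sum.inl (σ j) := by
          funext j
          by_cases h1 : j = p
          · subst h1; simp [M, hc]
          · by_cases h2 : j = q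
            · subst h2; simp [h1, not_lt.2 hc']
            · simp [M, h1, h2]
        rw [hf]
        ext e
        simp only [mem_image, mem_univ, true_and, mem_insert, mem_erase]
        constructor
        · rintro ⟨j, rfl⟩
          by_cases h1 : j = p <;> simp [h1]
        · rintro (rfl | ⟨a, ⟨ha, -⟩, rfl⟩)
          · exact ⟨p, by simp⟩
          · refine ⟨σ.symm a, ?_⟩
            have h1 : σ.symm a ≠ p := fun h' => ha (by rw [← h']; simp)
            simp [h1]
      · convert hM using 3 with j
        split_ifs with h
        · rfl
        · have h1 : j ≠ p := fun h' => by subst h'; omega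
          have h2 : j ≠ q := fun h' => by subst h'; omega
          simp [M, h1, h2]
  · rcases le_or_gt c p with hc | hc
    · convert hM using 3 with j
      split_ifs with h
      · have h1 : j ≠ p := fun h' => by subst h'; omega
        have h2 : j ≠ q := fun h' => by subst h'; omega
        simp [M, h1, h2, Equiv.swap_apply_of_ne_of_ne]
      · rfl
    · convert hbase (σ * Equiv.swap p q) using 3 with j
      split_ifs with h
      · rfl
      · have h1 : j ≠ p := fun h' => by subst h'; omega
        by_cases h2 : j = q
        · simp [M, h2, hpq.ne']
        · simp [M, h1, h2, Equiv.swap_apply_of_ne_of_ne]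

lemma exists_swap_chain {k : ℕ} [NeZero k] (m : ℕ) : ∀ τ : Equiv.Perm (Fin k), τ.support.card ≤ m →
    ∃ σ : ℕ → Equiv.Perm (Fin k), σ 0 = 1 ∧ (∀ t, m ≤ t → σ t = τ) ∧
      ∀ t, ∃ p q, σ (t + 1) = σ t * Equiv.swap p q := by
  induction m with
  | zero =>
    intro τ h
    have hτ : τ = 1 := by simpa using h
    subst hτ
    exact ⟨fun _ => 1, rfl, fun _ _ => rfl, fun t => ⟨0, 0, by rw [Equiv.swap_self]; rfl⟩⟩
  | succ m ih =>
    intro τ h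
    by_cases hτ : τ = 1
    · obtain ⟨σ, h0, h1, h2⟩ := ih τ (by simp [hτ])
      exact ⟨σ, h0, fun t ht => h1 t (by omega), h2⟩
    · obtain ⟨x, hx⟩ : ∃ x, τ x ≠ x := by
        by_contra! hc
        exact hτ (Equiv.ext hc)
      have hx' : τ⁻¹ x ≠ x := fun h' => hx (by rw [Equiv.Perm.inv_eq_iff_eq] at h'; exact h'.symm)
      have hcard := Equiv.Perm.card_support_swap_mul (f := τ⁻¹) hx'
      rw [Equiv.Perm.support_inv] at hcard
      obtain ⟨σ, h0, h1, h2⟩ := ih (τ * Equiv.swap x (τ⁻¹ x)) (by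
        rw [← Equiv.Perm.support_inv, mul_inv_rev, Equiv.swap_inv]
        omega)
      refine ⟨fun t => if t ≤ m then σ t else τ, by simp [h0], fun t ht => ?_, fun t => ?_⟩
      · exact if_neg (by omega)
      · rcases lt_trichotomy t m with ht | rfl | ht
        · simpa [ht.le, Nat.succ_le_of_lt ht] using h2 t
        · refine ⟨x, τ⁻¹ x, ?_⟩
          simp [h1 t le_rfl, mul_assoc]
        · refine ⟨x, x, ?_⟩
          rw [Equiv.swap_self]
          simp only [if_neg (not_le.2 ht), if_neg (not_le.2 (ht.trans (Nat.lt_succ_self t)))]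
          rfl

open Fin.NatCast Fin.CommRing in
/-- A walk on the seed which runs through the base edge in order at the beginning, and again
around time `s`. -/
lemma exists_seed_walk {k s : ℕ} [NeZero k] (hs : 5 * k ^ 2 ≤ s) :
    ∃ ω : ℕ → SeedVertex k,
      (∀ i, IsSeedEdge k (univ.image fun a : Fin k => ω (i + a))) ∧
      (∀ j : Fin k, ω j = Sum.inl j) ∧ (∀ j : Fin k, ω (s + j) = Sum.inl j) ∧
      (∀ j : Fin k, ω (s - k + j) = Sum.inl j) := by
  have hk : 0 < k := Nat.pos_of_neZero k
  let τ : Equiv.Perm (Fin k) := Equiv.subRight (s : Fin k)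
  obtain ⟨σ, σ0, στ, σs⟩ := exists_swap_chain k τ (by
    simpa using card_le_univ τ.support)
  have hM : ∀ t, ∃ M : Fin k → SeedVertex k, RoundsCompat k (fun j => Sum.inl (σ t j)) M ∧
      RoundsCompat k M (fun j => Sum.inl (σ (t + 1) j)) ∧
      (k ≤ t → M = fun j => Sum.inl (τ j)) := by
    intro t
    by_cases ht : k ≤ t
    · refine ⟨_, ?_, ?_, fun _ => rfl⟩
      · rw [στ t ht]; exact roundsCompat_perm τ
      · rw [στ (t + 1) (by omega)]; exact roundsCompat_perm τ
    · obtain ⟨p, q, h⟩ := σs t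
      obtain ⟨M, h1, h2⟩ := exists_round_between_swap (σ t) p q
      exact ⟨M, h1, h ▸ h2, fun h' => absurd h' ht⟩
  choose M hM1 hM2 hM3 using hM
  let R : ℕ → Fin k → SeedVertex k := fun t =>
    if t % 2 = 0 then fun j => Sum.inl (σ (t / 2) j) else M (t / 2)
  have hR : ∀ t, RoundsCompat k (R t) (R (t + 1)) := by
    intro t
    rcases Nat.mod_two_eq_zero_or_one t with h | h
    · have h1 : (t + 1) % 2 ≠ 0 := by omega
      have h2 : (t + 1) / 2 = t / 2 := by omega
      simp only [R, h, h1, h2, if_true, if_false]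
      exact hM1 _
    · have h1 : (t + 1) % 2 = 0 := by omega
      have h2 : (t + 1) / 2 = t / 2 + 1 := by omega
      simp only [R, h, h1, h2, if_true, one_ne_zero, if_false]
      exact hM2 _
  have hRτ : ∀ t, 2 * k ≤ t → R t = fun j => Sum.inl (τ j) := by
    intro t ht
    have h : k ≤ t / 2 := by omega
    simp only [R, στ _ h, hM3 _ h, ite_self]
  let ω : ℕ → SeedVertex k := fun i => R (i / k) (i : Fin k)
  have hval : ∀ i : ℕ, ((i : Fin k) : ℕ) = i % k := fun i => Fin.val_natCast i k
  have hlate : ∀ i j : ℕ, 2 * k ^ 2 ≤ i → (i : Fin k) = s + j → ω i = Sum.inl (j : Fin k) := by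
    intro i j hi hij
    have h : 2 * k ≤ i / k := by
      rw [Nat.le_div_iff_mul_le hk]
      linarith [sq k]
    simp only [ω, hRτ _ h, hij, τ, Equiv.subRight_apply, add_sub_cancel_left]
  have hk2 : k ≤ k ^ 2 := Nat.le_self_pow two_ne_zero k
  refine ⟨ω, fun i => ?_, fun j => ?_, fun j => ?_, fun j => ?_⟩
  · convert hR (i / k) (i % k) using 1
    ext e
    simp only [mem_image, mem_univ, true_and]
    have key : ∀ a : Fin k, ω (i + a) =
        if (((i + a : ℕ) : Fin k) : ℕ) < i % k then R (i / k + 1) ((i + a : ℕ) : Fin k)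
        else R (i / k) ((i + a : ℕ) : Fin k) := by
      intro a
      have h1 := Nat.div_add_mod i k
      have h2 := Nat.mod_lt i hk
      have h3 := a.isLt
      have hd : (i + a) / k = (i % k + a) / k + i / k := by
        conv_lhs => rw [← h1, add_assoc, Nat.mul_add_div hk]
        rw [add_comm]
      have hm : (i + a) % k = (i % k + a) % k := by simp
      simp only [ω]
      rw [hval, hm, hd]
      by_cases h : i % k + a < k
      · rw [Nat.div_eq_of_lt h, Nat.mod_eq_of_lt h, if_neg (by omega), zero_add]
      · have e1 : (i % k + a) / k = 1 := by
          rw [Nat.div_eq_iff hk]; constructor <;> omega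
        have e2 : (i % k + a) % k = i % k + a - k := by
          rw [Nat.mod_eq_sub_mod (by omega), Nat.mod_eq_of_lt (by omega)]
        rw [e1, e2, if_pos (by omega), add_comm]
    constructor
    · rintro ⟨a, rfl⟩
      exact ⟨((i + a : ℕ) : Fin k), (key a).symm⟩
    · rintro ⟨b, rfl⟩
      refine ⟨b - (i : Fin k), ?_⟩
      have h : ((i + ((b - (i : Fin k) : Fin k) : ℕ) : ℕ) : Fin k) = b := by
        simp
      rw [key, h]
  · have : (j : ℕ) / k = 0 := Nat.div_eq_of_lt j.isLt
    simp [ω, this, R, σ0]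
  · rw [hlate (s + j) j (by omega) (by simp)]
    simp
  · rw [hlate (s - k + j) j (by omega) ?_]
    · simp
    · have h : s - k + k = s := by omega
      have h' : ((s - k + k : ℕ) : Fin k) = s := by rw [h]
      rw [← h']
      simp

/-- `g` is a closed tight walk in `E` on `t + 1` cyclically ordered positions. -/
def IsClosedWalk {V : Type} [DecidableEq V] (k : ℕ) {t : ℕ} (E : Finset (Finset V))
    (g : Fin (t + 1) → V) : Prop :=
  ∀ i < t + 1, (range k).image (fun a => g (Fin.ofNat (t + 1) (i + a))) ∈ E

/-- `u` maps the seed into `E`, and its base vertex `0` can be replaced by `x` in the base edge. -/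
def IsSeedAt {V : Type} [DecidableEq V] (k : ℕ) [NeZero k] (E : Finset (Finset V)) (x : V)
    (u : SeedVertex k → V) : Prop :=
  (∀ e, IsSeedEdge k e → e.image u ∈ E) ∧
    insert x ((univ.erase 0).image fun l : Fin k => u (Sum.inl l)) ∈ E

lemma isClosedWalk_of_blowup {V : Type} [DecidableEq V] {k t : ℕ} [NeZero k]
    (hkt : 2 * k ≤ t + 1) {E : Finset (Finset V)} {x : V} {ω : ℕ → SeedVertex k}
    (hω : ∀ i, IsSeedEdge k (univ.image fun a : Fin k => ω (i + a)))
    (hω₀ : ∀ j : Fin k, ω j = Sum.inl j) (hω₁ : ∀ j : Fin k, ω (t + 1 - k + j) = Sum.inl j)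
    {u : SeedVertex k × Fin (t + 1) → V}
    (hu : ∀ j : SeedVertex k → Fin (t + 1), IsSeedAt k E x fun l => u (l, j l)) :
    IsClosedWalk k E (Fin.cons x fun p : Fin t => u (ω (p + 1), p.succ) : Fin (t + 1) → V) := by
  have hk : 0 < k := Nat.pos_of_neZero k
  set g : Fin (t + 1) → V := Fin.cons x fun p : Fin t => u (ω (p + 1), p.succ) with hg
  have hg0 : g 0 = x := rfl
  have hgs : ∀ p : ℕ, 0 < p → p < t + 1 → 
      g (Fin.ofNat (t + 1) p) = u (ω p, Fin.ofNat (t + 1) p) := by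
    intro p hp hpt
    obtain ⟨p, rfl⟩ := Nat.exists_eq_succ_of_ne_zero hp.ne'
    have : Fin.ofNat (t + 1) (p + 1) = Fin.succ ⟨p, by omega⟩ := by
      ext; simp [Nat.mod_eq_of_lt hpt]
    simp only [Nat.succ_eq_add_one, this, hg, Fin.cons_succ]
  have wrap : ∀ i, 0 < i → i ≤ t + 1 → t + 1 < i + k →
      (range k).image (fun a => g (Fin.ofNat (t + 1) (i + a))) ∈ E := by
    intro i hi hit hik
    convert (hu fun l => Sum.elim (fun l : Fin k => if (l : ℕ) < i + k - (t + 1) then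
      Fin.ofNat (t + 1) l else Fin.ofNat (t + 1) (t + 1 - k + l)) (fun _ => 0) l).2 using 1
    ext v
    simp only [mem_image, mem_range, mem_insert, mem_erase, mem_univ, and_true, Sum.elim_inl]
    constructor
    · rintro ⟨a, ha, rfl⟩
      by_cases h1 : i + a < t + 1
      · right
        refine ⟨⟨i + a - (t + 1 - k), by omega⟩, ?_, ?_⟩
        · intro h
          have := congrArg Fin.val h
          simp at this
          omega
        · have h2 : t + 1 - k + (i + a - (t + 1 - k)) = i + a := by omega
          have h3 := hω₁ ⟨i + a - (t + 1 - k), by omega⟩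
          simp only [h2] at h3
          rw [if_neg (by simp only; omega), hgs _ (by omega) h1, h3]
          simp only [h2]
      · have h2 : Fin.ofNat (t + 1) (i + a) = Fin.ofNat (t + 1) (i + a - (t + 1)) := by
          ext
          simp only [Fin.ofNat]
          rw [Nat.mod_eq_sub_mod (by omega)]
        rw [h2]
        by_cases h3 : i + a - (t + 1) = 0
        · left
          rw [h3]
          exact hg0
        · right
          refine ⟨⟨i + a - (t + 1), by omega⟩, ?_, ?_⟩
          · intro h
            exact h3 (by simpa using congrArg Fin.val h)
          · rw [if_pos (by simp only; omega), hgs _ (by omega) (by omega),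
              hω₀ ⟨i + a - (t + 1), by omega⟩]
    · rintro (rfl | ⟨l, hl, rfl⟩)
      · refine ⟨t + 1 - i, by omega, ?_⟩
        have h : i + (t + 1 - i) = t + 1 := by omega
        rw [h]
        have : Fin.ofNat (t + 1) (t + 1) = 0 := by ext; simp
        rw [this, hg0]
      · have hl0 : 0 < (l : ℕ) := Nat.pos_of_ne_zero fun h => hl (Fin.ext (by simpa using h))
        have hlk := l.isLt
        by_cases h : (l : ℕ) < i + k - (t + 1)
        · refine ⟨l + (t + 1) - i, by omega, ?_⟩
          have h1 : i + (l + (t + 1) - i) = l + (t + 1) := by omega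
          have h2 : Fin.ofNat (t + 1) (l + (t + 1)) = Fin.ofNat (t + 1) l := by
            ext; simp
          rw [h1, h2, if_pos h, hgs _ hl0 (by omega), hω₀]
        · refine ⟨t + 1 - k + l - i, by omega, ?_⟩
          have h1 : i + (t + 1 - k + l - i) = t + 1 - k + l := by omega
          rw [h1, if_neg h, hgs _ (by omega) (by omega), hω₁]
  intro i hi
  rcases Nat.eq_zero_or_pos i with rfl | hi0
  · convert wrap (t + 1) (by omega) le_rfl (by omega) using 4 with a
    ext
    simp
  · by_cases hik : t + 1 < i + k
    · exact wrap i hi0 hi.le hik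
    · have hinj : Function.Injective fun a : Fin k => ω (i + a) := by
        rw [← Set.injOn_univ, ← coe_univ, ← card_image_iff, (hω i).card_eq, card_univ,
          Fintype.card_fin]
      convert (hu fun l => Fin.ofNat (t + 1)
        (i + Function.invFun (fun a : Fin k => ω (i + a)) l)).1 _ (hω i) using 1
      ext v
      simp only [mem_image, mem_range, mem_univ, true_and, exists_exists_eq_and]
      constructor
      · rintro ⟨a, ha, rfl⟩
        refine ⟨⟨a, ha⟩, ?_⟩
        rw [Function.leftInverse_invFun hinj ⟨a, ha⟩, hgs _ (by omega) (by omega)]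
      · rintro ⟨a, rfl⟩
        refine ⟨a, a.isLt, ?_⟩
        have := a.isLt
        rw [Function.leftInverse_invFun hinj a, hgs _ (by omega) (by omega)]

open Classical in
lemma card_closedWalks_ge_of_seeds {V : Type} [Fintype V] [DecidableEq V] [Nonempty V] {k t : ℕ}
    [NeZero k] (hs : 5 * k ^ 2 ≤ t + 1) (E : Finset (Finset V)) (x y : V) {c : ℝ} (hc : 0 ≤ c)
    (h : c * (Fintype.card V : ℝ) ^ Fintype.card (SeedVertex k) ≤
      ((univ.filter fun u => IsSeedAt k E x u ∧ IsSeedAt k E y u).card : ℝ)) :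
    c ^ ((t + 1) ^ Fintype.card (SeedVertex k)) * (Fintype.card V : ℝ) ^ t ≤
      ((univ.filter fun h : Fin t → V => IsClosedWalk k E (Fin.cons x h : Fin (t + 1) → V) ∧
        IsClosedWalk k E (Fin.cons y h : Fin (t + 1) → V)).card : ℝ) := by
  have hn : (0 : ℝ) < Fintype.card V := by exact_mod_cast Fintype.card_pos
  have hk : 0 < k := Nat.pos_of_neZero k
  obtain ⟨ω, hω, hω₀, -, hω₁⟩ := exists_seed_walk hs
  have hkt : 2 * k ≤ t + 1 := by nlinarith
  have hblow := card_blowup_ge (t + 1)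
    (fun u : SeedVertex k → V => IsSeedAt k E x u ∧ IsSeedAt k E y u) hc h
  let φ : Fin t → SeedVertex k × Fin (t + 1) := fun p => (ω (p + 1), p.succ)
  have hφ : Function.Injective φ := fun p q hpq => by
    simpa [φ] using (Prod.ext_iff.1 hpq).2
  have hproj := card_filter_le_card_filter_comp hφ
    (fun u : SeedVertex k × Fin (t + 1) → V => ∀ j : SeedVertex k → Fin (t + 1),
      IsSeedAt k E x (fun l => u (l, j l)) ∧ IsSeedAt k E y (fun l => u (l, j l)))
    (fun h : Fin t → V => IsClosedWalk k E (Fin.cons x h : Fin (t + 1) → V) ∧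
        IsClosedWalk k E (Fin.cons y h : Fin (t + 1) → V))
    (fun u hu => ⟨isClosedWalk_of_blowup hkt hω hω₀ hω₁ fun j => (hu j).1,
      isClosedWalk_of_blowup hkt hω hω₀ hω₁ fun j => (hu j).2⟩)
  have hle : t ≤ Fintype.card (SeedVertex k × Fin (t + 1)) := by
    simpa using Fintype.card_le_of_injective φ hφ
  have hproj' := hblow.trans (Nat.cast_le.2 hproj)
  rw [Nat.cast_mul, Nat.cast_pow, Fintype.card_fin] at hproj'
  have hexp : Fintype.card (SeedVertex k) * (t + 1) =
      t + (Fintype.card (SeedVertex k × Fin (t + 1)) - t) := by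
    rw [Nat.add_sub_cancel' hle, Fintype.card_prod, Fintype.card_fin]
  rw [hexp, pow_add, ← mul_assoc] at hproj'
  exact le_of_mul_le_mul_right hproj' (by positivity)

/-- The vertices which form an edge together with `S`. -/
def nbrs {V : Type} [Fintype V] [DecidableEq V] (E : Finset (Finset V)) (S : Finset V) :
    Finset V := univ.filter fun v => insert v S ∈ E

lemma degS_le_card_nbrs {V : Type} [Fintype V] [DecidableEq V] {k : ℕ} {E : Finset (Finset V)}
    (hE : IsKGraph k E) {S : Finset V} (hS : S.card + 1 = k) :
    degS E S ≤ (nbrs E S).card := by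
  have hsub : (E.filter fun e => S ⊆ e) ⊆ (nbrs E S).image fun v => insert v S := by
    intro e he
    rw [mem_filter] at he
    have hc : (e \ S).card = 1 := by
      rw [card_sdiff_of_subset he.2, hE e he.1]
      omega
    obtain ⟨v, hv⟩ := card_eq_one.1 hc
    have : insert v S = e := by
      rw [insert_eq, ← hv, sdiff_union_of_subset he.2]
    exact mem_image.2 ⟨v, by simp [nbrs, this, he.1], this⟩
  exact (card_le_card hsub).trans card_image_le

lemma card_common_nbrs_ge {V : Type} [Fintype V] [DecidableEq V] {k : ℕ} {E : Finset (Finset V)}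
    (hE : IsKGraph k E) (hk : 0 < k) {γ : ℝ}
    (hdeg : ∀ S : Finset V, S.card = k - 1 →
      (1 / 2 + γ) * (Fintype.card V : ℝ) ≤ (degS E S : ℝ))
    {S S' : Finset V} (hS : S.card = k - 1) (hS' : S'.card = k - 1) :
    2 * γ * (Fintype.card V : ℝ) ≤ ((nbrs E S ∩ nbrs E S').card : ℝ) := by
  have h1 := (hdeg S hS).trans (Nat.cast_le.2 (degS_le_card_nbrs hE (by omega)))
  have h2 := (hdeg S' hS').trans (Nat.cast_le.2 (degS_le_card_nbrs hE (by omega)))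
  have h3 : ((nbrs E S).card : ℝ) + (nbrs E S').card ≤
      Fintype.card V + (nbrs E S ∩ nbrs E S').card := by
    have := card_union_add_card_inter (nbrs E S) (nbrs E S')
    have h4 := card_le_univ (nbrs E S ∪ nbrs E S')
    exact_mod_cast (by omega : (nbrs E S).card + (nbrs E S').card ≤
      Fintype.card V + (nbrs E S ∩ nbrs E S').card)
  linarith

lemma card_filter_mul_le_card_filter_cons {V : Type} [Fintype V] {m : ℕ}
    (P : (Fin m → V) → Prop) (Q : (Fin (m + 1) → V) → Prop) [DecidablePred P] [DecidablePred Q]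
    (S : (Fin m → V) → Finset V) {a : ℝ} (hS : ∀ t, P t → a ≤ ((S t).card : ℝ))
    (h : ∀ t, P t → ∀ v ∈ S t, Q (Fin.cons v t)) :
    ((univ.filter P).card : ℝ) * a ≤ ((univ.filter Q).card : ℝ) := by
  have h1 : ((univ.filter P).sigma S).card ≤ (univ.filter Q).card := by
    refine card_le_card_of_injOn (fun p => Fin.cons p.2 p.1) (fun p hp => ?_) ?_
    · simp only [coe_sigma, Set.mem_sigma_iff, coe_filter, mem_univ, true_and, Set.mem_ofPred_eq,
        mem_coe] at hp ⊢
      exact h _ hp.1 _ hp.2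
    · rintro ⟨t, v⟩ _ ⟨t', v'⟩ _ he
      obtain ⟨rfl, rfl⟩ := Fin.cons_inj.1 he
      rfl
  refine le_trans ?_ (Nat.cast_le.2 h1)
  rw [card_sigma, Nat.cast_sum, ← nsmul_eq_mul]
  exact card_nsmul_le_sum _ _ _ fun t ht => hS t (mem_filter.1 ht).2

lemma card_filter_mul_le_card_filter_pi {A B J W : Type} [Fintype A] [Fintype B] [Fintype J]
    [DecidableEq J] [Fintype W] (P : A → Prop) (Q : B → Prop) [DecidablePred P] [DecidablePred Q]
    (S : A → J → Finset W) {a : ℝ} (ha : 0 ≤ a) (hS : ∀ v, P v → ∀ j, a ≤ ((S v j).card : ℝ))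
    (F : A → (J → W) → B) (hF : ∀ v w v' w', F v w = F v' w' → v = v' ∧ w = w')
    (h : ∀ v, P v → ∀ w, (∀ j, w j ∈ S v j) → Q (F v w)) :
    ((univ.filter P).card : ℝ) * a ^ Fintype.card J ≤ ((univ.filter Q).card : ℝ) := by
  have h1 : ((univ.filter P).sigma fun v => Fintype.piFinset (S v)).card ≤
      (univ.filter Q).card := by
    refine card_le_card_of_injOn (fun p => F p.1 p.2) (fun p hp => ?_) ?_
    · simp only [coe_sigma, Set.mem_sigma_iff, coe_filter, mem_univ, true_and, Set.mem_ofPred_eq,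
        mem_coe, Fintype.mem_piFinset] at hp ⊢
      exact h _ hp.1 _ hp.2
    · rintro ⟨t, v⟩ _ ⟨t', v'⟩ _ he
      obtain ⟨rfl, rfl⟩ := hF _ _ _ _ he
      rfl
  refine le_trans ?_ (Nat.cast_le.2 h1)
  rw [card_sigma, Nat.cast_sum, ← nsmul_eq_mul]
  refine card_nsmul_le_sum _ _ _ fun t ht => ?_
  rw [Fintype.card_piFinset, Nat.cast_prod, ← card_univ, ← prod_const]
  exact prod_le_prod (fun _ _ => ha) fun j _ => hS t (mem_filter.1 ht).2 j

lemma image_univ_cons {V : Type} [DecidableEq V] {m : ℕ} (a : V) (t : Fin m → V) :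
    univ.image (Fin.cons a t : Fin (m + 1) → V) = insert a (univ.image t) := by
  ext v
  simp [Fin.exists_fin_succ, eq_comm]

lemma image_erase_zero_cons {V : Type} [DecidableEq V] {m : ℕ} (a : V) (t : Fin m → V) :
    (univ.erase 0).image (Fin.cons a t : Fin (m + 1) → V) = univ.image t := by
  ext v
  simp [Fin.exists_fin_succ, Fin.succ_ne_zero]

open Classical in
lemma card_seeds_ge {V : Type} [Fintype V] [DecidableEq V] [Nonempty V] {K : ℕ}
    {E : Finset (Finset V)}
    (hE : IsKGraph (K + 2) E) {γ : ℝ} (hγ : 0 < γ)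
    (hdeg : ∀ S : Finset V, S.card = K + 2 - 1 →
      (1 / 2 + γ) * (Fintype.card V : ℝ) ≤ (degS E S : ℝ))
    (hn : 2 * (K ^ 2 + K * 2) ≤ Fintype.card V) (x y : V) :
    1 / 2 * (2 * γ) * (1 / 2) * (2 * γ) ^ ((K + 2) * (K + 2)) *
      (Fintype.card V : ℝ) ^ Fintype.card (SeedVertex (K + 2)) ≤
      ((univ.filter fun u => IsSeedAt (K + 2) E x u ∧ IsSeedAt (K + 2) E y u).card : ℝ) := by
  have hn0 : (0 : ℝ) < Fintype.card V := by exact_mod_cast Fintype.card_pos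
  set n : ℝ := (Fintype.card V : ℝ) with hn_def
  let P₀ : (Fin K → V) → Prop := fun t => Function.Injective t ∧ ∀ i, t i ∉ ({x, y} : Finset V)
  let P₁ : (Fin (K + 1) → V) → Prop := fun v =>
    insert x (univ.image v) ∈ E ∧ insert y (univ.image v) ∈ E
  let P₂ : (Fin (K + 2) → V) → Prop := fun v => univ.image v ∈ E ∧
    insert x ((univ.erase 0).image v) ∈ E ∧ insert y ((univ.erase 0).image v) ∈ E
  have h₀ : 1 / 2 * n ^ K ≤ ((univ.filter P₀).card : ℝ) := by
    have hbad := card_not_injective_or_meets_mul_le (ι := Fin K) ({x, y} : Finset V)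
    have htot := card_filter_add_card_filter_not (s := (univ : Finset (Fin K → V))) P₀
    rw [card_univ, Fintype.card_fun, Fintype.card_fin] at htot
    have h2 : ({x, y} : Finset V).card ≤ 2 := card_le_two
    rw [Fintype.card_fin] at hbad
    set b := (univ.filter fun t : Fin K → V => ¬ P₀ t).card with hb
    have hbad' : 2 * b * Fintype.card V ≤ Fintype.card V ^ K * Fintype.card V := by
      calc 2 * b * Fintype.card V = 2 * (b * Fintype.card V) := by ring
        _ ≤ 2 * ((K ^ 2 + K * 2) * Fintype.card V ^ K) := by
          refine Nat.mul_le_mul_left _ (hbad.trans ?_)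
          gcongr
        _ = 2 * (K ^ 2 + K * 2) * Fintype.card V ^ K := by ring
        _ ≤ Fintype.card V * Fintype.card V ^ K := by gcongr
        _ = _ := by ring
    have hb2 := Nat.le_of_mul_le_mul_right hbad' Fintype.card_pos
    have : (Fintype.card V : ℝ) ^ K ≤ 2 * ((univ.filter P₀).card : ℝ) := by
      exact_mod_cast (by omega : Fintype.card V ^ K ≤ 2 * (univ.filter P₀).card)
    linarith
  have h₁ : ((univ.filter P₀).card : ℝ) * (2 * γ * n) ≤ ((univ.filter P₁).card : ℝ) := by
    refine card_filter_mul_le_card_filter_cons P₀ P₁ (fun t =>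
      nbrs E (insert x (univ.image t)) ∩ nbrs E (insert y (univ.image t))) (fun t ht => ?_)
      fun t ht a ha => ?_
    · have hx : x ∉ univ.image t := by
        intro h
        obtain ⟨i, -, hi⟩ := mem_image.1 h
        exact ht.2 i (by simp [hi])
      have hy : y ∉ univ.image t := by
        intro h
        obtain ⟨i, -, hi⟩ := mem_image.1 h
        exact ht.2 i (by simp [hi])
      refine card_common_nbrs_ge hE (by omega) hdeg ?_ ?_
      · rw [card_insert_of_notMem hx, card_image_of_injective _ ht.1]; simp
      · rw [card_insert_of_notMem hy, card_image_of_injective _ ht.1]; simp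
    · simp only [nbrs, mem_inter, mem_filter, mem_univ, true_and] at ha
      simp only [P₁, image_univ_cons]
      rw [insert_comm, insert_comm y]
      exact ha
  have h₂ : ((univ.filter P₁).card : ℝ) * (1 / 2 * n) ≤ ((univ.filter P₂).card : ℝ) := by
    refine card_filter_mul_le_card_filter_cons P₁ P₂ (fun v => nbrs E (univ.image v))
      (fun v hv => ?_) fun v hv z hz => ?_
    · have hc : (univ.image v).card = K + 1 := by
        have h1 := hE _ hv.1
        have h2 := card_insert_le x (univ.image v)
        have h3 := card_image_le (s := univ) (f := v)
        simp only [card_univ, Fintype.card_fin] at h3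
        omega
      refine le_trans ?_ ((hdeg _ hc).trans (Nat.cast_le.2 (degS_le_card_nbrs hE (by omega))))
      gcongr
      linarith
    · simp only [nbrs, mem_filter, mem_univ, true_and] at hz
      simp only [P₂, image_univ_cons, image_erase_zero_cons]
      exact ⟨hz, hv⟩
  have h₃ : ((univ.filter P₂).card : ℝ) * (2 * γ * n) ^ ((K + 2) * (K + 2)) ≤
      ((univ.filter fun u => IsSeedAt (K + 2) E x u ∧ IsSeedAt (K + 2) E y u).card : ℝ) := by
    have := card_filter_mul_le_card_filter_pi (J := Fin (K + 2) × Fin (K + 2)) P₂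
      (fun u => IsSeedAt (K + 2) E x u ∧ IsSeedAt (K + 2) E y u)
      (fun v p => nbrs E ((univ.erase p.1).image v) ∩ nbrs E ((univ.erase p.2).image v))
      (a := 2 * γ * n) (by positivity) (fun v hv p => ?_) Sum.elim
      (fun v w v' w' h => ⟨by simpa using congrArg (· ∘ Sum.inl) h,
        by simpa using congrArg (· ∘ Sum.inr) h⟩) (fun v hv w hw => ?_)
    · simpa using this
    · have hinj : Function.Injective v := by
        rw [← Set.injOn_univ, ← coe_univ, ← card_image_iff, hE _ hv.1, card_univ,
          Fintype.card_fin]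
      refine card_common_nbrs_ge hE (by omega) hdeg ?_ ?_ <;>
      · rw [card_image_of_injective _ hinj, card_erase_of_mem (mem_univ _)]; simp
    · simp only [nbrs, mem_inter, mem_filter, mem_univ, true_and] at hw
      have hseed : ∀ e, IsSeedEdge (K + 2) e → e.image (Sum.elim v w) ∈ E := by
        rintro e (rfl | ⟨i, j, rfl | rfl⟩)
        · simpa [image_image, Function.comp_def] using hv.1
        · simpa [image_insert, image_image, Function.comp_def] using (hw (i, j)).1
        · simpa [image_insert, image_image, Function.comp_def] using (hw (i, j)).2
      exact ⟨⟨hseed, hv.2.1⟩, ⟨hseed, hv.2.2⟩⟩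
  calc _ = 1 / 2 * n ^ K * (2 * γ * n) * (1 / 2 * n) * (2 * γ * n) ^ ((K + 2) * (K + 2)) := by
        have : Fintype.card (SeedVertex (K + 2)) = K + 1 + 1 + (K + 2) * (K + 2) := by
          simp
        rw [this, mul_pow _ n, pow_add n, pow_succ n, pow_succ n]
        ring
    _ ≤ _ := by
        refine le_trans ?_ h₃
        gcongr
        refine le_trans ?_ h₂
        gcongr
        refine le_trans ?_ h₁
        gcongr

lemma spansCs_of_isClosedWalk {V : Type} [DecidableEq V] {k t : ℕ} (hkt : k ≤ t + 1)
    {E : Finset (Finset V)} {g : Fin (t + 1) → V} (hg : Function.Injective g)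
    (h : IsClosedWalk k E g) : SpansCs k (t + 1) E (univ.image g) := by
  have hlist : ∀ p < 2 * (t + 1),
      (List.ofFn g ++ List.ofFn g)[p]? = some (g (Fin.ofNat (t + 1) p)) := by
    intro p hp
    by_cases h1 : p < t + 1
    · rw [List.getElem?_append_left (by simpa using h1)]
      simp only [List.getElem?_ofFn, h1, dif_pos]
      congr 2
      ext
      simp [Nat.mod_eq_of_lt h1]
    · rw [List.getElem?_append_right (by simpa using h1)]
      have h2 : p - (t + 1) < t + 1 := by omega
      simp only [List.length_ofFn, List.getElem?_ofFn, h2, dif_pos]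
      congr 2
      ext
      simp only [Fin.ofNat]
      rw [Nat.mod_eq_sub_mod (by omega), Nat.mod_eq_of_lt h2]
  refine ⟨List.ofFn g, by simp, ⟨List.nodup_ofFn.2 hg, fun i hi => ?_⟩, ?_⟩
  · rw [List.length_ofFn] at hi
    convert h i hi using 1
    ext v
    simp only [List.mem_toFinset, mem_image, mem_range, List.mem_iff_getElem?]
    constructor
    · rintro ⟨a, ha⟩
      rw [List.getElem?_take] at ha
      split_ifs at ha with hak
      rw [List.getElem?_drop, hlist _ (by omega), Option.some_inj] at ha
      exact ⟨a, hak, ha⟩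
    · rintro ⟨a, hak, rfl⟩
      refine ⟨a, ?_⟩
      rw [List.getElem?_take, if_pos hak, List.getElem?_drop, hlist _ (by omega)]
  · ext v
    simp only [List.mem_toFinset, List.mem_ofFn, mem_image, mem_univ, true_and]

lemma SpansCs.hasPerfectCsTilingOn {V : Type} [DecidableEq V] {k s : ℕ}
    {E : Finset (Finset V)} {A : Finset V} (h : SpansCs k s E A) :
    HasPerfectCsTilingOn k s E A :=
  ⟨{A}, ⟨by simp, by simpa using h⟩, by simp⟩

lemma HasPerfectCsTilingOn.union {V : Type} [DecidableEq V] {k s : ℕ}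
    {E : Finset (Finset V)} {A B : Finset V} (hA : HasPerfectCsTilingOn k s E A)
    (hB : HasPerfectCsTilingOn k s E B) (hAB : Disjoint A B) :
    HasPerfectCsTilingOn k s E (A ∪ B) := by
  obtain ⟨T, ⟨hT1, hT2⟩, rfl⟩ := hA
  obtain ⟨T', ⟨hT1', hT2'⟩, rfl⟩ := hB
  refine ⟨T ∪ T', ⟨?_, fun C hC => ?_⟩, union_biUnion⟩
  · rw [coe_union]
    refine hT1.union hT1' fun C hC D hD _ => ?_
    exact hAB.mono (subset_biUnion_of_mem id hC) (subset_biUnion_of_mem id hD)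
  · rcases mem_union.1 hC with h | h
    · exact hT2 C h
    · exact hT2' C h

lemma hasPerfectCsTilingOn_biUnion {V ι : Type} [DecidableEq V] {k s : ℕ}
    {E : Finset (Finset V)} (I : Finset ι) (X : ι → Finset V)
    (hd : (I : Set ι).PairwiseDisjoint X) (h : ∀ i ∈ I, HasPerfectCsTilingOn k s E (X i)) :
    HasPerfectCsTilingOn k s E (I.biUnion X) := by
  classical
  induction I using Finset.induction_on with
  | empty => exact ⟨∅, ⟨by simp, by simp⟩, by simp⟩
  | insert i I hi ih =>
    rw [biUnion_insert]
    refine (h i (mem_insert_self i I)).union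
      (ih (hd.subset (by simp)) fun j hj => h j (mem_insert_of_mem hj)) ?_
    rw [disjoint_biUnion_right]
    intro j hj
    exact hd (by simp) (by simp [hj]) (by rintro rfl; exact hi hj)

/-- `A` consists of `t + 1` closed walks, such that the vertices `w` can be exchanged for the
initial vertices of these walks, and the latter form a closed walk themselves. -/
def IsAbsorber {V : Type} [DecidableEq V] (k : ℕ) {t : ℕ} (E : Finset (Finset V))
    (w : Fin (t + 1) → V) (A : Fin (t + 1) × Fin (t + 1) → V) : Prop :=
  (∀ i, IsClosedWalk k E fun j => A (i, j)) ∧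
    (∀ i, IsClosedWalk k E (Fin.cons (w i) fun j : Fin t => A (i, j.succ) : Fin (t + 1) → V)) ∧
    IsClosedWalk k E fun i => A (i, 0)

lemma IsAbsorber.hasPerfectCsTilingOn {V : Type} [DecidableEq V] {k t : ℕ} (hkt : k ≤ t + 1)
    {E : Finset (Finset V)} {w : Fin (t + 1) → V} {A : Fin (t + 1) × Fin (t + 1) → V}
    (h : IsAbsorber k E w A) (hA : Function.Injective A) :
    HasPerfectCsTilingOn k (t + 1) E (univ.image A) := by
  have : univ.image A = univ.biUnion fun i => univ.image fun j => A (i, j) := by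
    ext v
    simp
  rw [this]
  refine hasPerfectCsTilingOn_biUnion _ _ (fun i _ i' _ hii => ?_) fun i _ =>
    (spansCs_of_isClosedWalk hkt (fun j j' hj => (Prod.ext_iff.1 (hA hj)).2)
      (h.1 i)).hasPerfectCsTilingOn
  rw [Function.onFun, Finset.disjoint_left]
  simp only [mem_image, mem_univ, true_and]
  rintro _ ⟨j, rfl⟩ ⟨j', hj'⟩
  exact hii (Prod.ext_iff.1 (hA hj')).1.symm

lemma IsAbsorber.hasPerfectCsTilingOn_union {V : Type} [DecidableEq V] {k t : ℕ} (hkt : k ≤ t + 1)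
    {E : Finset (Finset V)} {w : Fin (t + 1) → V} {A : Fin (t + 1) × Fin (t + 1) → V}
    (h : IsAbsorber k E w A) (hA : Function.Injective A) (hw : Function.Injective w)
    (hAw : ∀ i p, A p ≠ w i) :
    HasPerfectCsTilingOn k (t + 1) E (univ.image A ∪ univ.image w) := by
  have : univ.image A ∪ univ.image w =
      (univ.biUnion fun i => univ.image
        (Fin.cons (w i) fun j : Fin t => A (i, j.succ) : Fin (t + 1) → V)) ∪
      univ.image fun i => A (i, 0) := by
    ext v
    simp only [image_univ_cons, mem_union, mem_image, mem_biUnion, mem_insert, mem_univ, true_and,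
      Prod.exists, exists_or, eq_comm (a := v)]
    have : (∃ a b, A (a, b) = v) ↔ (∃ a, A (a, 0) = v) ∨ ∃ a, ∃ b : Fin t, A (a, b.succ) = v := by
      rw [← exists_or]
      exact exists_congr fun a => Fin.exists_fin_succ
    rw [this]
    constructor
    · rintro ((h | h) | h)
      exacts [Or.inr h, Or.inl (Or.inr h), Or.inl (Or.inl h)]
    · rintro ((h | h) | h)
      exacts [Or.inr h, Or.inl (Or.inr h), Or.inl (Or.inl h)]
  rw [this]
  refine (hasPerfectCsTilingOn_biUnion _ _ (fun i _ i' _ hii => ?_) fun i _ =>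
    (spansCs_of_isClosedWalk hkt ?_ (h.2.1 i)).hasPerfectCsTilingOn).union
    (spansCs_of_isClosedWalk hkt (fun j j' hj => (Prod.ext_iff.1 (hA hj)).1)
      h.2.2).hasPerfectCsTilingOn ?_
  · rw [Function.onFun, image_univ_cons, image_univ_cons, Finset.disjoint_left]
    simp only [mem_insert, mem_image, mem_univ, true_and]
    rintro _ (rfl | ⟨j, rfl⟩) (hj' | ⟨j', hj'⟩)
    · exact hii (hw hj')
    · exact hAw _ _ hj'
    · exact hAw _ _ hj'
    · exact hii (Prod.ext_iff.1 (hA hj')).1.symm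
  · refine Fin.cons_injective_iff.2 ⟨?_, fun j j' hj => ?_⟩
    · rintro ⟨j, hj⟩
      exact hAw _ _ hj
    · exact Fin.succ_injective _ (Prod.ext_iff.1 (hA hj)).2
  · rw [Finset.disjoint_left]
    simp only [mem_image, mem_biUnion, image_univ_cons, mem_insert, mem_univ, true_and]
    rintro _ ⟨i, rfl | ⟨j, rfl⟩⟩ ⟨j', hj'⟩
    · exact hAw _ _ hj'
    · exact Fin.succ_ne_zero _ (Prod.ext_iff.1 (hA hj')).2.symm

/-- A disjoint family of absorbing tuples. -/
def IsAbsorbingFamily {V : Type} [DecidableEq V] (k : ℕ) {t : ℕ} (E : Finset (Finset V))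
    (F : Finset (Fin (t + 1) × Fin (t + 1) → V)) : Prop :=
  (∀ A ∈ F, Function.Injective A ∧ ∃ w, IsAbsorber k E w A) ∧
    (F : Set (Fin (t + 1) × Fin (t + 1) → V)).PairwiseDisjoint fun A => univ.image A

lemma IsAbsorbingFamily.mono {V : Type} [DecidableEq V] {k t : ℕ} {E : Finset (Finset V)}
    {F F' : Finset (Fin (t + 1) × Fin (t + 1) → V)} (h : IsAbsorbingFamily k E F)
    (hF : F' ⊆ F) : IsAbsorbingFamily k E F' :=
  ⟨fun A hA => h.1 A (hF hA), h.2.subset (by exact_mod_cast hF)⟩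

open Classical in
lemma IsAbsorbingFamily.hasPerfectCsTilingOn_union {V : Type} [DecidableEq V] {k t : ℕ}
    (hkt : k ≤ t + 1) {E : Finset (Finset V)} (m : ℕ) :
    ∀ F : Finset (Fin (t + 1) × Fin (t + 1) → V), IsAbsorbingFamily k E F →
      (∀ w, m ≤ (F.filter (IsAbsorber k E w)).card) →
      ∀ W : Finset V, Disjoint (F.biUnion fun A => univ.image A) W → W.card = (t + 1) * m →
        HasPerfectCsTilingOn k (t + 1) E ((F.biUnion fun A => univ.image A) ∪ W) := by
  induction m with
  | zero =>
    intro F hF _ W _ hW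
    have hW0 : W = ∅ := by simpa using hW
    rw [hW0, union_empty]
    refine hasPerfectCsTilingOn_biUnion _ _ hF.2 fun A hA => ?_
    obtain ⟨hA1, w, hw⟩ := hF.1 A hA
    exact hw.hasPerfectCsTilingOn hkt hA1
  | succ m ih =>
    intro F hF hm W hFW hW
    obtain ⟨W₁, hW₁, hcard⟩ := exists_subset_card_eq (s := W) (n := t + 1) (by rw [hW]; nlinarith)
    let w : Fin (t + 1) → V := fun i => ((W₁.equivFinOfCardEq hcard).symm i : V)
    have hw : Function.Injective w :=
      Subtype.val_injective.comp (W₁.equivFinOfCardEq hcard).symm.injective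
    have himg : univ.image w = W₁ := by
      refine eq_of_subset_of_card_le (fun v hv => ?_) ?_
      · obtain ⟨i, -, rfl⟩ := mem_image.1 hv
        exact ((W₁.equivFinOfCardEq hcard).symm i).2
      · rw [card_image_of_injective _ hw, hcard]; simp
    obtain ⟨A, hA⟩ := card_pos.1 ((Nat.succ_pos m).trans_le (hm w))
    rw [mem_filter] at hA
    have hAU : univ.image A ⊆ F.biUnion fun A => univ.image A :=
      subset_biUnion_of_mem (fun A => univ.image A) hA.1
    have hFA : (F.biUnion fun A => univ.image A) =
        ((F.erase A).biUnion fun A => univ.image A) ∪ univ.image A := by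
      conv_lhs => rw [← insert_erase hA.1, biUnion_insert, union_comm]
    have hsub : ((F.erase A).biUnion fun A => univ.image A) ⊆ F.biUnion fun A => univ.image A :=
      biUnion_subset_biUnion_of_subset_left _ (erase_subset _ _)
    have hdis : Disjoint ((F.erase A).biUnion fun A => univ.image A) (univ.image A) := by
      rw [disjoint_biUnion_left]
      intro B hB
      exact hF.2 (mem_of_mem_erase hB) hA.1 (ne_of_mem_erase hB)
    have h1 := ih (F.erase A) (hF.mono (erase_subset _ _)) (fun w' => by
      rw [filter_erase]
      have := pred_card_le_card_erase (s := F.filter (IsAbsorber k E w')) (a := A)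
      have := hm w'
      omega) (W \ W₁) (hFW.mono hsub sdiff_subset) (by
        rw [card_sdiff_of_subset hW₁, hW, hcard, mul_add, mul_one, Nat.add_sub_cancel])
    have h2 := hA.2.hasPerfectCsTilingOn_union hkt (hF.1 A hA.1).1 hw (fun i p h => by
      refine Finset.disjoint_left.1 hFW (hAU (mem_image_of_mem A (mem_univ p))) (hW₁ ?_)
      rw [h, ← himg]
      exact mem_image_of_mem w (mem_univ i))
    have hunion := h1.union h2 (by
      rw [himg, disjoint_union_left, disjoint_union_right, disjoint_union_right]
      exact ⟨⟨hdis, hFW.mono hsub hW₁⟩,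
        (hFW.mono hAU sdiff_subset).symm, sdiff_disjoint⟩)
    convert hunion using 1
    rw [hFA, himg, union_union_union_comm, sdiff_union_of_subset hW₁]

open Classical in
/-- Many tuples absorb any given tuple if any two vertices have many common completions to a
closed walk. -/
lemma card_isAbsorber_ge {V : Type} [Fintype V] [DecidableEq V] {k t : ℕ}
    {E : Finset (Finset V)} {c : ℝ} (hc : 0 ≤ c)
    (h : ∀ x y : V, c * (Fintype.card V : ℝ) ^ t ≤
      ((univ.filter fun h : Fin t → V => IsClosedWalk k E (Fin.cons x h : Fin (t + 1) → V) ∧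
        IsClosedWalk k E (Fin.cons y h : Fin (t + 1) → V)).card : ℝ))
    (w : Fin (t + 1) → V) :
    c ^ (t + 2) * (Fintype.card V : ℝ) ^ Fintype.card (Fin (t + 1) × Fin (t + 1)) ≤
      ((univ.filter (IsAbsorber k E w)).card : ℝ) := by
  have h₁ : (Fintype.card V : ℝ) * (c * (Fintype.card V : ℝ) ^ t) ≤
      ((univ.filter fun Y : Fin (t + 1) → V => IsClosedWalk k E Y).card : ℝ) := by
    have := card_filter_mul_le_card_filter_pi (J := Unit) (fun _ : V => True)
      (fun Y : Fin (t + 1) → V => IsClosedWalk k E Y)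
      (fun x _ => univ.filter fun h : Fin t → V =>
        IsClosedWalk k E (Fin.cons x h : Fin (t + 1) → V) ∧
        IsClosedWalk k E (Fin.cons x h : Fin (t + 1) → V))
      (by positivity) (fun x _ _ => h x x) (fun x g => Fin.cons x (g ()))
      (fun x g x' g' he => ⟨(Fin.cons_inj.1 he).1, funext fun _ => (Fin.cons_inj.1 he).2⟩)
      (fun x _ g hg => by simpa using hg ())
    simpa using this
  have h₂ := card_filter_mul_le_card_filter_pi (J := Fin (t + 1))
    (fun Y : Fin (t + 1) → V => IsClosedWalk k E Y) (IsAbsorber k E w)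
    (fun Y i => univ.filter fun h : Fin t → V =>
      IsClosedWalk k E (Fin.cons (w i) h : Fin (t + 1) → V) ∧
      IsClosedWalk k E (Fin.cons (Y i) h : Fin (t + 1) → V))
    (by positivity) (fun Y _ i => h (w i) (Y i))
    (fun Y g p => (Fin.cons (Y p.1) (g p.1) : Fin (t + 1) → V) p.2)
    (fun Y g Y' g' he => by
      have he' : ∀ i, (Fin.cons (Y i) (g i) : Fin (t + 1) → V) = Fin.cons (Y' i) (g' i) :=
        fun i => funext fun j => congrFun he (i, j)
      exact ⟨funext fun i => (Fin.cons_inj.1 (he' i)).1,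
        funext fun i => (Fin.cons_inj.1 (he' i)).2⟩)
    (fun Y hY g hg => by
      simp only [mem_filter, mem_univ, true_and] at hg
      exact ⟨fun i => (hg i).2, fun i => by simpa using (hg i).1, by simpa using hY⟩)
  refine le_trans (le_of_eq ?_) ((mul_le_mul_of_nonneg_right h₁ (by positivity)).trans h₂)
  simp only [Fintype.card_prod, Fintype.card_fin]
  ring

open Classical in
/-- Many of the functions satisfying a property are injective and avoid a given small set. -/
lemma card_filter_and_injective_ge {ι V : Type} [Fintype ι] [DecidableEq ι] [Fintype V] [Nonempty V]
    (P : (ι → V) → Prop) {c : ℝ} (hP : c * (Fintype.card V : ℝ) ^ Fintype.card ι ≤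
      ((univ.filter P).card : ℝ)) (F : Finset V)
    (hF : (Fintype.card ι : ℝ) ^ 2 + Fintype.card ι * F.card ≤ c / 2 * Fintype.card V) :
    c / 2 * (Fintype.card V : ℝ) ^ Fintype.card ι ≤
      ((univ.filter fun g => P g ∧ Function.Injective g ∧ ∀ i, g i ∉ F).card : ℝ) := by
  have hn : (0 : ℝ) < Fintype.card V := by exact_mod_cast Fintype.card_pos
  have h₁ : ((univ.filter fun g : ι → V => ¬(Function.Injective g ∧ ∀ i, g i ∉ F)).card : ℝ) *
      Fintype.card V ≤ ((Fintype.card ι : ℝ) ^ 2 + Fintype.card ι * F.card) *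
        (Fintype.card V : ℝ) ^ Fintype.card ι := by
    exact_mod_cast card_not_injective_or_meets_mul_le (ι := ι) F
  have h₂ : ((univ.filter fun g : ι → V => ¬(Function.Injective g ∧ ∀ i, g i ∉ F)).card : ℝ) ≤
      c / 2 * (Fintype.card V : ℝ) ^ Fintype.card ι := by
    refine le_of_mul_le_mul_right (h₁.trans ?_) hn
    rw [mul_right_comm]
    gcongr
  have h₃ : univ.filter P ⊆ (univ.filter fun g => P g ∧ Function.Injective g ∧ ∀ i, g i ∉ F) ∪
      univ.filter fun g : ι → V => ¬(Function.Injective g ∧ ∀ i, g i ∉ F) := by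
    intro g hg
    simp only [mem_union, mem_filter, mem_univ, true_and] at hg ⊢
    tauto
  have h₄ := (card_le_card h₃).trans (card_union_le _ _)
  have h₅ : ((univ.filter P).card : ℝ) ≤
      ((univ.filter fun g => P g ∧ Function.Injective g ∧ ∀ i, g i ∉ F).card : ℝ) +
      ((univ.filter fun g : ι → V => ¬(Function.Injective g ∧ ∀ i, g i ∉ F)).card : ℝ) := by
    exact_mod_cast h₄
  linarith

open Classical in
/-- If each `y` is related to a `δ`-fraction of the admissible elements, one can choose
successively `N` elements such that the potential counting the relations decreases by a constant
factor in every step. -/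
lemma exists_finset_potential_le {X Y : Type} [Fintype X] [DecidableEq X] [Nonempty X] [Fintype Y]
    (R : Y → X → Prop) (P : Finset X → Prop) (Ok : Finset X → X → Prop) {δ : ℝ}
    (hδ : δ ≤ 1) (N : ℕ) (hP : P ∅)
    (hOk : ∀ F x y, P F → R y x → Ok F x → x ∉ F ∧ P (insert x F))
    (h : ∀ F y, P F → F.card < N → δ * Fintype.card X ≤
      ((univ.filter fun x => R y x ∧ Ok F x).card : ℝ)) (hY : Nonempty Y) (hδ₀ : 0 < δ) :
    ∃ F, F.card = N ∧ P F ∧ ∑ y, (1 / 2 : ℝ) ^ (F.filter (R y)).card ≤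
      Fintype.card Y * (1 - δ / 2) ^ N := by
  suffices H : ∀ M ≤ N, ∃ F, F.card = M ∧ P F ∧ ∑ y, (1 / 2 : ℝ) ^ (F.filter (R y)).card ≤
      Fintype.card Y * (1 - δ / 2) ^ M from H N le_rfl
  intro M
  induction M with
  | zero => exact fun _ => ⟨∅, by simp, hP, by simp⟩
  | succ M ih =>
    intro hM
    obtain ⟨F, hF, hPF, hΦ⟩ := ih (by omega)
    let q : Y → ℝ := fun y => (1 / 2 : ℝ) ^ (F.filter (R y)).card
    have hq : ∀ y, 0 < q y := fun y => by positivity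
    have hX : (0 : ℝ) < Fintype.card X := by exact_mod_cast Fintype.card_pos
    have hsum : ∑ _x : X, δ * ∑ y, q y ≤
        ∑ x, ∑ y, if R y x ∧ Ok F x then q y else 0 := by
      rw [sum_comm, sum_const, nsmul_eq_mul, card_univ, mul_sum, mul_sum]
      refine sum_le_sum fun y _ => ?_
      rw [← sum_filter, sum_const, nsmul_eq_mul, ← mul_assoc, mul_comm _ δ]
      exact mul_le_mul_of_nonneg_right (h F y hPF (by omega)) (hq y).le
    obtain ⟨x, -, hx⟩ := exists_le_of_sum_le univ_nonempty hsum
    have hpos : 0 < δ * ∑ y, q y := by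
      have := sum_pos (s := univ) (fun y _ => hq y) univ_nonempty
      positivity
    obtain ⟨y₀, hy₀⟩ : ∃ y, R y x ∧ Ok F x := by
      by_contra! hcon
      refine absurd (hpos.trans_le hx) (not_lt.2 (le_of_eq (sum_eq_zero fun y _ => ?_)))
      rw [if_neg fun hy => hcon y hy.1 hy.2]
    obtain ⟨hxF, hPx⟩ := hOk F x y₀ hPF hy₀.1 hy₀.2
    refine ⟨insert x F, by rw [card_insert_of_notMem hxF, hF], hPx, ?_⟩
    have hstep : ∀ y, (1 / 2 : ℝ) ^ ((insert x F).filter (R y)).card =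
        q y - 1 / 2 * if R y x ∧ Ok F x then q y else 0 := by
      intro y
      by_cases hy : R y x
      · rw [filter_insert, if_pos hy, card_insert_of_notMem (by simp [hxF]), pow_succ,
          if_pos ⟨hy, hy₀.2⟩]
        simp only [q]
        ring
      · rw [filter_insert, if_neg hy, if_neg fun h => hy h.1]
        simp [q]
    rw [sum_congr rfl fun y _ => hstep y, sum_sub_distrib, ← mul_sum]
    calc _ ≤ (∑ y, q y) * (1 - δ / 2) := by linarith
      _ ≤ Fintype.card Y * (1 - δ / 2) ^ M * (1 - δ / 2) :=
        mul_le_mul_of_nonneg_right hΦ (by linarith)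
      _ = _ := by ring

lemma IsAbsorbingFamily.card_biUnion {V : Type} [DecidableEq V] {k t : ℕ}
    {E : Finset (Finset V)} {F : Finset (Fin (t + 1) × Fin (t + 1) → V)}
    (h : IsAbsorbingFamily k E F) :
    (F.biUnion fun A => univ.image A).card = F.card * ((t + 1) * (t + 1)) := by
  rw [Finset.card_biUnion fun A hA B hB => h.2 hA hB]
  rw [sum_const_nat fun A hA => by rw [card_image_of_injective _ (h.1 A hA).1]]
  simp

lemma IsAbsorbingFamily.insert {V : Type} [DecidableEq V] {k t : ℕ} {E : Finset (Finset V)}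
    {F : Finset (Fin (t + 1) × Fin (t + 1) → V)} (h : IsAbsorbingFamily k E F)
    {w : Fin (t + 1) → V} {A : Fin (t + 1) × Fin (t + 1) → V} (hw : IsAbsorber k E w A)
    (hA : Function.Injective A) (hd : ∀ p, A p ∉ F.biUnion fun A => univ.image A) :
    A ∉ F ∧ IsAbsorbingFamily k E (insert A F) := by
  have hdis : ∀ B ∈ F, Disjoint (univ.image A) (univ.image B) := by
    intro B hB
    rw [Finset.disjoint_left]
    intro v hv hvB
    obtain ⟨p, -, rfl⟩ := mem_image.1 hv
    exact hd p (mem_biUnion.2 ⟨B, hB, hvB⟩)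
  refine ⟨fun hAF => hd 0 (mem_biUnion.2 ⟨A, hAF, mem_image_of_mem A (mem_univ 0)⟩), ?_, ?_⟩
  · intro B hB
    rcases mem_insert.1 hB with rfl | hB
    exacts [⟨hA, w, hw⟩, h.1 B hB]
  · rw [coe_insert]
    exact h.2.insert fun B hB _ => hdis B hB

open Classical in
lemma exists_isAbsorbingFamily {V : Type} [Fintype V] [DecidableEq V] [Nonempty V] {k t : ℕ}
    {E : Finset (Finset V)} {δ : ℝ} (hδ₀ : 0 < δ) (hδ : δ ≤ 1)
    (h : ∀ w : Fin (t + 1) → V,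
      2 * δ * (Fintype.card V : ℝ) ^ Fintype.card (Fin (t + 1) × Fin (t + 1)) ≤
        ((univ.filter (IsAbsorber k E w)).card : ℝ)) (N : ℕ)
    (hN : (((t + 1) * (t + 1) : ℕ) : ℝ) ^ 2 * (N + 1) ≤ δ * Fintype.card V) :
    ∃ F : Finset (Fin (t + 1) × Fin (t + 1) → V), F.card = N ∧ IsAbsorbingFamily k E F ∧
      ∀ w, (1 / 2 : ℝ) ^ (F.filter (IsAbsorber k E w)).card ≤
        (Fintype.card V : ℝ) ^ (t + 1) * (1 - δ / 2) ^ N := by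
  have hmany : ∀ (F : Finset (Fin (t + 1) × Fin (t + 1) → V)) (w : Fin (t + 1) → V),
      IsAbsorbingFamily k E F → F.card < N →
      δ * Fintype.card (Fin (t + 1) × Fin (t + 1) → V) ≤
        ((univ.filter fun A => IsAbsorber k E w A ∧ Function.Injective A ∧
          ∀ p, A p ∉ F.biUnion fun A => univ.image A).card : ℝ) := by
    intro F w hF hFN
    have hcard : ((F.biUnion fun A => univ.image A).card : ℝ) ≤
        N * ((t + 1) * (t + 1) : ℕ) := by
      have : F.card * ((t + 1) * (t + 1)) ≤ N * ((t + 1) * (t + 1)) :=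
        Nat.mul_le_mul_right _ hFN.le
      rw [hF.card_biUnion]
      exact_mod_cast this
    have := card_filter_and_injective_ge (IsAbsorber k E w) (h w)
      (F.biUnion fun A => univ.image A) (by
        rw [Fintype.card_prod, Fintype.card_fin]
        have := mul_le_mul_of_nonneg_left hcard (Nat.cast_nonneg (α := ℝ) ((t + 1) * (t + 1)))
        linarith)
    rw [mul_div_cancel_left₀ δ two_ne_zero] at this
    rw [Fintype.card_fun, Nat.cast_pow]
    refine this.trans (le_of_eq ?_)
    congr!
  have hempty : IsAbsorbingFamily (t := t) k E ∅ := ⟨by simp, by simp⟩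
  obtain ⟨F, hF, hFa, hΦ⟩ := exists_finset_potential_le (fun w A => IsAbsorber k E w A)
    (IsAbsorbingFamily (t := t) k E)
    (fun F A => Function.Injective A ∧ ∀ p, A p ∉ F.biUnion fun A => univ.image A)
    hδ N hempty (fun F A w hF hw hA => hF.insert hw hA.1 hA.2)
    (fun F w hF hFN => (hmany F w hF hFN).trans (le_of_eq (by congr!))) inferInstance hδ₀
  refine ⟨F, hF, hFa, fun w => le_trans ?_ (hΦ.trans (le_of_eq ?_))⟩
  · exact single_le_sum (f := fun w => (1 / 2 : ℝ) ^ (F.filter (IsAbsorber k E w)).card)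
      (fun _ _ => by positivity) (mem_univ w)
  · rw [Fintype.card_fun, Fintype.card_fin, Nat.cast_pow]

lemma lt_of_half_pow_le {δ β n : ℝ} {r N h m : ℕ} (hδ₀ : 0 < δ) (hδ : δ ≤ 1)
    (hN : β * n < N + 1) (hm : (m : ℝ) ≤ δ * β / 4 * n)
    (hn : 2 * Real.exp (δ / 2) * n ^ r ≤ Real.exp (δ * β / 4 * n))
    (hh : (1 / 2 : ℝ) ^ h ≤ n ^ r * (1 - δ / 2) ^ N) (hn₀ : 0 < n) : m ≤ h := by
  by_contra! hlt
  have h₁ : Real.exp (-(δ * β / 4 * n)) ≤ (1 / 2 : ℝ) ^ h := by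
    calc Real.exp (-(δ * β / 4 * n)) ≤ Real.exp (-h) := by
          have : (h : ℝ) ≤ m := by exact_mod_cast hlt.le
          exact Real.exp_le_exp.2 (by linarith)
      _ = Real.exp (-1) ^ h := by rw [← Real.exp_nat_mul]; simp
      _ ≤ _ := by
          gcongr
          linarith [Real.exp_neg_one_lt_half]
  have h₂ : (1 - δ / 2) ^ N ≤ Real.exp (δ / 2) * Real.exp (-(δ * β / 2 * n)) := by
    calc (1 - δ / 2) ^ N ≤ Real.exp (-(δ / 2)) ^ N := by
          gcongr
          · linarith
          · exact Real.one_sub_le_exp_neg _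
      _ = Real.exp (N * -(δ / 2)) := by rw [← Real.exp_nat_mul]
      _ ≤ Real.exp (δ / 2 + -(δ * β / 2 * n)) := by
          refine Real.exp_le_exp.2 ?_
          nlinarith
      _ = _ := Real.exp_add _ _
  have h₃ : Real.exp (-(δ * β / 2 * n)) =
      Real.exp (-(δ * β / 4 * n)) * Real.exp (-(δ * β / 4 * n)) := by
    rw [← Real.exp_add]
    ring_nf
  have h₄ : Real.exp (δ * β / 4 * n) * Real.exp (-(δ * β / 4 * n)) = 1 := by
    rw [← Real.exp_add]
    simp
  set e := Real.exp (-(δ * β / 4 * n))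
  have he : 0 < e := Real.exp_pos _
  have h₅ : e ≤ n ^ r * (Real.exp (δ / 2) * (e * e)) := by
    rw [← h₃]
    exact h₁.trans (hh.trans (by gcongr))
  have h₆ := mul_le_mul_of_nonneg_right hn (mul_nonneg he.le he.le)
  have h₇ : Real.exp (δ * β / 4 * n) * (e * e) = e := by rw [← mul_assoc, h₄, one_mul]
  rw [h₇] at h₆
  nlinarith

/-- the absorbing lemma: for `k ≥ 3`, `s ≥ 5k²`, `γ > 0` and suitable
`μ ≪ γ` and `α ≪ μ`, every `k`-graph on `n ≥ n₀` vertices with minimum codegree at least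
`(1/2 + γ)n` has an absorbing set `U` of size at most `μn` divisible by `s` such that
`H[U ∪ W]` has a perfect `C_s^k`-tiling for every small `W` with `s ∣ |W|`. -/
theorem absorbing_lemma (k s : ℕ) (hk : 3 ≤ k) (hs : 5 * k ^ 2 ≤ s) (γ : ℝ) (hγ : 0 < γ) :
    ∃ μ₀ : ℝ, 0 < μ₀ ∧ ∀ μ : ℝ, 0 < μ → μ ≤ μ₀ →
      ∃ α₀ : ℝ, 0 < α₀ ∧ ∀ α : ℝ, 0 < α → α ≤ α₀ →
        ∃ n₀ : ℕ, ∀ (V : Type) [Fintype V] [DecidableEq V] (E : Finset (Finset V)),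
          IsKGraph k E → n₀ ≤ Fintype.card V →
          (∀ S : Finset V, S.card = k - 1 →
            (1 / 2 + γ) * (Fintype.card V : ℝ) ≤ (degS E S : ℝ)) →
          ∃ U : Finset V, (U.card : ℝ) ≤ μ * (Fintype.card V : ℝ) ∧ s ∣ U.card ∧
            ∀ W : Finset V, W ⊆ Finset.univ \ U →
              (W.card : ℝ) ≤ α * (Fintype.card V : ℝ) → s ∣ W.card →
              HasPerfectCsTilingOn k s E (U ∪ W) := by
  obtain ⟨K, rfl⟩ : ∃ K, k = K + 2 := ⟨k - 2, by omega⟩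
  obtain ⟨t, rfl⟩ : ∃ t, s = t + 1 :=
    ⟨s - 1, by nlinarith [Nat.sub_add_cancel (show 1 ≤ s by nlinarith)]⟩
  have hkt : K + 2 ≤ t + 1 := by nlinarith
  obtain ⟨c, hc, hcdef⟩ : ∃ c : ℝ, 0 < c ∧
      c = (1 / 2 * (2 * γ) * (1 / 2) * (2 * γ) ^ ((K + 2) * (K + 2))) ^
        ((t + 1) ^ Fintype.card (SeedVertex (K + 2))) := ⟨_, by positivity, rfl⟩
  obtain ⟨δ, hδ₀, hδ, hδc⟩ : ∃ δ : ℝ, 0 < δ ∧ δ ≤ 1 ∧ 2 * δ ≤ c ^ (t + 2) :=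
    ⟨min 1 (c ^ (t + 2) / 2), by positivity, min_le_left _ _, by
      linarith [min_le_right 1 (c ^ (t + 2) / 2)]⟩
  obtain ⟨M, hM⟩ : ∃ M : ℝ, M = (((t + 1) * (t + 1) : ℕ) : ℝ) := ⟨_, rfl⟩
  have hM₀ : 0 < M := by rw [hM]; positivity
  refine ⟨1, one_pos, fun μ hμ _ => ?_⟩
  obtain ⟨β, hβ₀, hβμ, hβδ⟩ : ∃ β : ℝ, 0 < β ∧ β * M ≤ μ ∧ M ^ 2 * β ≤ δ / 2 := by
    refine ⟨min (μ / M) (δ / 2 / M ^ 2), by positivity, ?_, ?_⟩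
    · exact (le_div_iff₀ hM₀).1 (min_le_left _ _)
    · exact (le_div_iff₀' (by positivity)).1 (min_le_right _ _)
  refine ⟨δ * β / 4, by positivity, fun α hα hα₀ => ?_⟩
  have hlim := ((isLittleO_pow_exp_pos_mul_atTop (t + 1) (b := δ * β / 4) (by positivity)).bound
    (c := 1 / (2 * Real.exp (δ / 2))) (by positivity))
  obtain ⟨x₀, hx₀⟩ := Filter.eventually_atTop.1 hlim
  obtain ⟨n₀, hn₀⟩ := exists_nat_ge (max x₀ (M ^ 2 / (δ / 2)))
  refine ⟨n₀ + 2 * (K ^ 2 + K * 2) + 1, fun V _ _ E hE hV hdeg => ?_⟩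
  classical
  have hpos : 0 < Fintype.card V := by omega
  have : Nonempty V := Fintype.card_pos_iff.1 hpos
  have hn : (0 : ℝ) < Fintype.card V := by exact_mod_cast hpos
  have hnn₀ : (n₀ : ℝ) ≤ Fintype.card V := by
    exact_mod_cast (by omega : n₀ ≤ Fintype.card V)
  have hexp : 2 * Real.exp (δ / 2) * (Fintype.card V : ℝ) ^ (t + 1) ≤
      Real.exp (δ * β / 4 * Fintype.card V) := by
    have := hx₀ _ ((le_max_left _ _).trans (hn₀.trans hnn₀))
    rw [Real.norm_of_nonneg (by positivity), Real.norm_of_nonneg (by positivity),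
      one_div_mul_eq_div, le_div_iff₀' (by positivity)] at this
    exact this
  have hMn : M ^ 2 ≤ δ / 2 * Fintype.card V :=
    (div_le_iff₀' (by positivity)).1 ((le_max_right _ _).trans (hn₀.trans hnn₀))
  have hwalk := fun x y => card_closedWalks_ge_of_seeds hs E x y (by positivity)
    (card_seeds_ge hE hγ hdeg (by omega) x y)
  rw [← hcdef] at hwalk
  obtain ⟨N, hN⟩ : ∃ N, N = ⌊β * Fintype.card V⌋₊ := ⟨_, rfl⟩
  have hNle : (N : ℝ) ≤ β * Fintype.card V := hN ▸ Nat.floor_le (by positivity)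
  obtain ⟨F, hFN, hF, hpot⟩ := exists_isAbsorbingFamily hδ₀ hδ (fun w =>
    (mul_le_mul_of_nonneg_right hδc (by positivity)).trans
      (card_isAbsorber_ge hc.le hwalk w)) N (by
        rw [← hM]
        have h₁ := mul_le_mul_of_nonneg_left hNle (sq_nonneg M)
        have h₂ := mul_le_mul_of_nonneg_right hβδ hn.le
        linarith)
  refine ⟨F.biUnion fun A => univ.image A, ?_, ?_, fun W hW hWα hWs => ?_⟩
  · rw [hF.card_biUnion, hFN, Nat.cast_mul, ← hM]
    calc (N : ℝ) * M ≤ β * Fintype.card V * M := by gcongr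
      _ = β * M * Fintype.card V := by ring
      _ ≤ μ * Fintype.card V := by gcongr
  · rw [hF.card_biUnion]
    exact Dvd.intro_left (F.card * (t + 1)) (mul_assoc _ _ _)
  · obtain ⟨m, hm⟩ := hWs
    refine hF.hasPerfectCsTilingOn_union hkt m F (fun w => ?_) W
      (disjoint_of_subset_right hW disjoint_sdiff) hm
    refine lt_of_half_pow_le hδ₀ hδ (hN ▸ Nat.lt_floor_add_one _) ?_ hexp (hpot w) hn
    have : (m : ℝ) ≤ W.card := by
      exact_mod_cast hm ▸ Nat.le_mul_of_pos_left m (Nat.succ_pos t)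
    exact this.trans (hWα.trans (by gcongr))
end
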